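/- For every L_⊗-sentence φ there exist N ∈ ℕ, d ∈ ℕ_{>0}, a subset 𝔦 ⊆ {0,…,N} and a subset 𝔯 ⊆ {1,…,d} such that T_MSO(Fin) ⊨ φ ↔ (⋁_{i ∈ 𝔦} ψ_{=i} ∨ (ψ_{>N} ∧ ⋁_{h ∈ 𝔯} ρ_{d,h})). -/

import Mathlib

open FirstOrder FirstOrder.Language

namespace MSO

/-! ### The language `L_⊗` and its semantics -/

/-- The language `L_⊗`: a constant `⊥`, a unary relation `At`,
and two binary relations: `⊆` (encoded `true`) and `≤ᴱ` (encoded `false`). -/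
def Lmso : Language where
  Functions := fun n => match n with | 0 => Unit | _ => Empty
  Relations := fun n => match n with | 1 => Unit | 2 => Bool | _ => Empty

/-- The constant symbol `⊥`. -/
def botC : Lmso.Constants := Unit.unit
/-- The unary relation symbol `At`. -/
def atR : Lmso.Relations 1 := Unit.unit
/-- The binary relation symbol `⊆`. -/
def subR : Lmso.Relations 2 := true
/-- The binary relation symbol `≤ᴱ`. -/
def exleR : Lmso.Relations 2 := false

/-- The interpretation of `⊥` in an `L_⊗`-structure. -/
def botE (M : Type*) [Lmso.Structure M] : M := Structure.funMap botC ![]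
/-- The interpretation of `At` in an `L_⊗`-structure. -/
def atE {M : Type*} [Lmso.Structure M] (a : M) : Prop := Structure.RelMap atR ![a]
/-- The interpretation of `⊆` in an `L_⊗`-structure. -/
def subE {M : Type*} [Lmso.Structure M] (a b : M) : Prop := Structure.RelMap subR ![a, b]
/-- The interpretation of `≤ᴱ` in an `L_⊗`-structure. -/
def exleE {M : Type*} [Lmso.Structure M] (a b : M) : Prop := Structure.RelMap exleR ![a, b]

/-- The monadic second order version `M̃SO(α)` of a linear order `α`, as an `L_⊗`-structure:
the universe is the powerset of `α`, `⊆` is inclusion, `⊥` is `∅`, `At` holds of singletons,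
and `A ≤ᴱ B` iff there are `a ∈ A` and `b ∈ B` with `a < b`. -/
instance msoStructure (α : Type*) [LinearOrder α] : Lmso.Structure (Set α) where
  funMap := fun {n} f _ => match n, f with
    | 0, _ => (∅ : Set α)
  RelMap := fun {n} r v => match n, r with
    | 1, _ => ∃ a : α, v 0 = {a}
    | 2, true => v 0 ⊆ v 1
    | 2, false => ∃ a ∈ v 0, ∃ b ∈ v 1, a < b

/-- `MSO(n)`, the monadic second order version of the `n`-element linear order. -/
abbrev MSOn (n : ℕ) : Type := Set (Fin n)

/-- The operation `⊗` on `L_⊗`-structures: the universe is the product, `⊆` is componentwise,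
`⊥` is the pair of bottoms, `At` holds of the atoms (minimal non-bottom elements) of the
resulting order, and `(A,B) ≤ᴱ (C,D)` iff (`A ≠ ⊥` and `D ≠ ⊥`), or `A ≤ᴱ C`, or `B ≤ᴱ D`. -/
instance tensorStructure (M N : Type*) [Lmso.Structure M] [Lmso.Structure N] :
    Lmso.Structure (M × N) where
  funMap := fun {n} f _ => match n, f with
    | 0, _ => (botE M, botE N)
  RelMap := fun {n} r v => match n, r with
    | 1, _ => v 0 ≠ (botE M, botE N) ∧
        ∀ q : M × N, subE q.1 (v 0).1 → subE q.2 (v 0).2 →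
          q = (botE M, botE N) ∨ q = v 0
    | 2, true => subE (v 0).1 (v 1).1 ∧ subE (v 0).2 (v 1).2
    | 2, false => ((v 0).1 ≠ botE M ∧ (v 1).2 ≠ botE N) ∨
        exleE (v 0).1 (v 1).1 ∨ exleE (v 0).2 (v 1).2

/-! ### Formulas -/

/-- Bounded `L_⊗`-formulas with no free (outer) variables. -/
abbrev BF (n : ℕ) := Lmso.BoundedFormula Empty n

/-- The `i`-th de Bruijn variable as a term. -/
def tv {n : ℕ} (i : Fin n) : Lmso.Term (Empty ⊕ Fin n) := Term.var (Sum.inr i)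
/-- The constant `⊥` as a term. -/
def tb {n : ℕ} : Lmso.Term (Empty ⊕ Fin n) := Constants.term botC

def sub' {n : ℕ} (i j : Fin n) : BF n := subR.boundedFormula₂ (tv i) (tv j)
def exle' {n : ℕ} (i j : Fin n) : BF n := exleR.boundedFormula₂ (tv i) (tv j)
def at' {n : ℕ} (i : Fin n) : BF n := atR.boundedFormula₁ (tv i)
def eq' {n : ℕ} (i j : Fin n) : BF n := Term.bdEqual (tv i) (tv j)
def isBot' {n : ℕ} (i : Fin n) : BF n := Term.bdEqual (tv i) tb
def botSub' {n : ℕ} (i : Fin n) : BF n := subR.boundedFormula₂ tb (tv i)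

/-- Finite conjunction. -/
def bigAnd {n : ℕ} (l : List (BF n)) : BF n := l.foldr (· ⊓ ·) ⊤
/-- Finite disjunction. -/
def bigOr {n : ℕ} (l : List (BF n)) : BF n := l.foldr (· ⊔ ·) ⊥

/-- `k` is the meet of `i` and `j` (with respect to `⊆`). -/
def isMeet {n : ℕ} (k i j : Fin n) : BF n :=
  sub' k i ⊓ sub' k j ⊓
    ∀' ((sub' (Fin.last n) i.castSucc ⊓ sub' (Fin.last n) j.castSucc) ⟹
      sub' (Fin.last n) k.castSucc)

/-- `k` is the join of `i` and `j` (with respect to `⊆`). -/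
def isJoin {n : ℕ} (k i j : Fin n) : BF n :=
  sub' i k ⊓ sub' j k ⊓
    ∀' ((sub' i.castSucc (Fin.last n) ⊓ sub' j.castSucc (Fin.last n)) ⟹
      sub' k.castSucc (Fin.last n))

/-- The meet of `i` and `j` is `⊥`. -/
def meetIsBot {n : ℕ} (i j : Fin n) : BF n :=
  ∀' ((sub' (Fin.last n) i.castSucc ⊓ sub' (Fin.last n) j.castSucc) ⟹ isBot' (Fin.last n))

/-- The join of `i` and `j` is the top element. -/
def joinIsTop {n : ℕ} (i j : Fin n) : BF n :=
  ∀' ((sub' i.castSucc (Fin.last n) ⊓ sub' j.castSucc (Fin.last n)) ⟹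
    ∀' (sub' (Fin.last (n + 1)) ((Fin.last n).castSucc)))

/-- `j` is a (Boolean) complement of `i`. -/
def isComplOf {n : ℕ} (j i : Fin n) : BF n := meetIsBot i j ⊓ joinIsTop i j

/-- `i` is an atom: non-bottom, and minimal among non-bottom elements. -/
def isAtomDef {n : ℕ} (i : Fin n) : BF n :=
  ∼(isBot' i) ⊓
    ∀' (sub' (Fin.last n) i.castSucc ⟹ (isBot' (Fin.last n) ⊔ eq' (Fin.last n) i.castSucc))

/-! ### The base theory `T_base` -/

def axRefl : Lmso.Sentence := ∀' sub' 0 0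
def axAntisymm : Lmso.Sentence := ∀' ∀' ((sub' 0 1 ⊓ sub' 1 0) ⟹ eq' 0 1)
def axTrans : Lmso.Sentence := ∀' ∀' ∀' ((sub' 0 1 ⊓ sub' 1 2) ⟹ sub' 0 2)
def axBotLe : Lmso.Sentence := ∀' botSub' 0
def axTop : Lmso.Sentence := ∃' ∀' (sub' 1 0)
def axMeet : Lmso.Sentence := ∀' ∀' ∃' (isMeet 2 0 1)
def axJoin : Lmso.Sentence := ∀' ∀' ∃' (isJoin 2 0 1)
def axCompl : Lmso.Sentence := ∀' ∃' (isComplOf 1 0)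
def axDistrib : Lmso.Sentence :=
  ∀' ∀' ∀' ∀' ∀' ∀' ∀' ∀'
    ((isMeet 3 0 1 ⊓ isMeet 4 0 2 ⊓ isJoin 5 1 2 ⊓ isMeet 6 0 5 ⊓ isJoin 7 3 4) ⟹ sub' 6 7)
def axAt : Lmso.Sentence := ∀' (at' 0 ⇔ isAtomDef 0)
def axAtomic : Lmso.Sentence := ∀' (∼(isBot' 0) ⟹ ∃' (at' 1 ⊓ sub' 1 0))
def axIrrefl : Lmso.Sentence := ∀' (at' 0 ⟹ ∼(exle' 0 0))
def axTransAt : Lmso.Sentence :=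
  ∀' ∀' ∀' ((at' 0 ⊓ at' 1 ⊓ at' 2 ⊓ exle' 0 1 ⊓ exle' 1 2) ⟹ exle' 0 2)
def axTrich : Lmso.Sentence :=
  ∀' ∀' ((at' 0 ⊓ at' 1) ⟹ (exle' 0 1 ⊔ eq' 0 1 ⊔ exle' 1 0))
def axExleDef : Lmso.Sentence :=
  ∀' ∀' (exle' 0 1 ⇔ ∃' ∃' (at' 2 ⊓ at' 3 ⊓ sub' 2 0 ⊓ sub' 3 1 ⊓ exle' 2 3))

/-- The comprehension axiom for a formula `η(x; Y₁,…,Yₙ)` (with `x` the last variable):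
`∀ Ȳ ∃ X ∀ x (At x → (x ⊆ X ↔ η(x; Ȳ)))`. -/
def compAx {n : ℕ} (η : BF (n + 1)) : Lmso.Sentence :=
  BoundedFormula.alls (∃' ∀' (at' (Fin.last (n + 1)) ⟹
    (sub' (Fin.last (n + 1)) ((Fin.last n).castSucc) ⇔ η.liftAt 1 n)))

/-- The base theory `T_base`: an atomic Boolean algebra under `⊆` with bottom `⊥`, `At`
holding exactly of the atoms, `≤ᴱ` linearly ordering the atoms and determined by its
restriction to the atoms, together with the comprehension scheme. -/
def Tbase : Lmso.Theory :=
  {axRefl, axAntisymm, axTrans, axBotLe, axTop, axMeet, axJoin, axCompl, axDistrib,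
    axAt, axAtomic, axIrrefl, axTransAt, axTrich, axExleDef} ∪
  ⋃ n : ℕ, Set.range (compAx (n := n))

/-! ### The theory `T_MSO(Fin)` -/

/-- `i` is the `≤ᴱ`-least atom. -/
def isLeastAtom {n : ℕ} (i : Fin n) : BF n :=
  at' i ⊓ ∀' (at' (Fin.last n) ⟹ ∼(exle' (Fin.last n) i.castSucc))

/-- `i` is the `≤ᴱ`-greatest atom. -/
def isGreatestAtom {n : ℕ} (i : Fin n) : BF n :=
  at' i ⊓ ∀' (at' (Fin.last n) ⟹ ∼(exle' i.castSucc (Fin.last n)))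

/-- `j` is the immediate `≤ᴱ`-successor of the atom `i`. -/
def isSuccOf {n : ℕ} (j i : Fin n) : BF n :=
  at' i ⊓ at' j ⊓ exle' i j ⊓
    ∀' ((at' (Fin.last n) ⊓ exle' i.castSucc (Fin.last n)) ⟹
      (eq' (Fin.last n) j.castSucc ⊔ exle' j.castSucc (Fin.last n)))

def axLeastAtom : Lmso.Sentence := (∃' at' 0) ⟹ ∃' isLeastAtom 0
def axGreatestAtom : Lmso.Sentence := (∃' at' 0) ⟹ ∃' isGreatestAtom 0
def axSucc : Lmso.Sentence :=
  ∀' ((at' 0 ⊓ ∃' (at' 1 ⊓ exle' 0 1)) ⟹ ∃' isSuccOf 1 0)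
def axPred : Lmso.Sentence :=
  ∀' ((at' 0 ⊓ ∃' (at' 1 ⊓ exle' 1 0)) ⟹ ∃' isSuccOf 0 1)
def axLeastIn : Lmso.Sentence :=
  ∀' (∼(isBot' 0) ⟹ ∃' (at' 1 ⊓ sub' 1 0 ⊓ ∀' ((at' 2 ⊓ sub' 2 0) ⟹ ∼(exle' 2 1))))

/-- The theory `T_MSO(Fin)`: `T_base` together with axioms saying that the ordering of the
atoms is discrete with endpoints, and every non-bottom element contains a least atom. -/
def TMSOFin : Lmso.Theory :=
  Tbase ∪ {axLeastAtom, axGreatestAtom, axSucc, axPred, axLeastIn}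

/-! ### Quantifier rank, unnested formulas, and `≈ₖ` -/

/-- Quantifier rank of a bounded formula. -/
def qr : ∀ {n : ℕ}, BF n → ℕ
  | _, BoundedFormula.falsum => 0
  | _, BoundedFormula.equal _ _ => 0
  | _, BoundedFormula.rel _ _ => 0
  | _, BoundedFormula.imp f g => max (qr f) (qr g)
  | _, BoundedFormula.all f => qr f + 1

/-- A formula is unnested if every atomic subformula is of one of the forms
`x = y`, `c = y`, or `R x̄` with the `xᵢ`, `y` variables (Hodges). -/
def IsUnnested : ∀ {n : ℕ}, BF n → Prop
  | _, BoundedFormula.falsum => True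
  | _, BoundedFormula.equal s t =>
      (∃ i j, s = Term.var i ∧ t = Term.var j) ∨
      (∃ (c : Lmso.Constants) (j : _), s = Constants.term c ∧ t = Term.var j)
  | _, BoundedFormula.rel _ ts => ∀ i, ∃ j, ts i = Term.var j
  | _, BoundedFormula.imp f g => IsUnnested f ∧ IsUnnested g
  | _, BoundedFormula.all f => IsUnnested f

/-- `M ≈ₖ N` : `M` and `N` satisfy the same unnested `L_⊗`-sentences of quantifier
rank at most `k`. -/
def EquivK (k : ℕ) (M N : Type*) [Lmso.Structure M] [Lmso.Structure N] : Prop :=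
  ∀ φ : Lmso.Sentence, IsUnnested φ → qr φ ≤ k → (M ⊨ φ ↔ N ⊨ φ)

/-! ### The sentences `ρ_{d,h}`, `ψ_{>n}`, `ψ_{=n}` -/

/-- The index (in `Fin d`) of `A_h` among `A₁, …, A_d`, identifying `h = 0` with `h = d`. -/
def aIdx (d h : ℕ) (hd : 0 < d) : Fin d := ⟨(h + d - 1) % d, Nat.mod_lt _ hd⟩

/-- The cyclic successor on the indices `{1, …, d}`. -/
def cyc {d : ℕ} (j : Fin d) : Fin d := ⟨((j : ℕ) + 1) % d, Nat.mod_lt _ j.pos⟩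

/-- The sentence `ρ_{d,h}`: there is a partition of the atoms into `d` non-bottom elements
`A₁, …, A_d` such that the least atom is in `A₁`, the immediate successor of an atom lying in
`A_j` lies in `A_{j+1}` (cyclically), and the greatest atom is in `A_h`. -/
def rho (d h : ℕ) : Lmso.Sentence :=
  if hd : 0 < d then
    BoundedFormula.exs (n := d) (
      -- each `A_i` is non-bottom
      bigAnd ((List.finRange d).map fun i => ∼(isBot' i)) ⊓
      -- every atom lies in some `A_i`
      (∀' (at' (Fin.last d) ⟹
        bigOr ((List.finRange d).map fun i => sub' (Fin.last d) i.castSucc))) ⊓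
      -- the `A_i` are pairwise disjoint on atoms
      bigAnd ((List.finRange d).flatMap fun i => (List.finRange d).filterMap fun j =>
        if i.val < j.val then
          some (∀' (at' (Fin.last d) ⟹
            ∼(sub' (Fin.last d) i.castSucc ⊓ sub' (Fin.last d) j.castSucc)))
        else none) ⊓
      -- the least atom lies in `A₁`
      (∀' (isLeastAtom (Fin.last d) ⟹ sub' (Fin.last d) ((aIdx d 1 hd).castSucc))) ⊓
      -- immediate successors move cyclically through the `A_j`
      bigAnd ((List.finRange d).map fun j =>
        ∀' ∀' ((sub' ((Fin.last d).castSucc) (j.castSucc.castSucc) ⊓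
            isSuccOf (Fin.last (d + 1)) ((Fin.last d).castSucc)) ⟹
          sub' (Fin.last (d + 1)) ((cyc j).castSucc.castSucc))) ⊓
      -- the greatest atom lies in `A_h`
      (∀' (isGreatestAtom (Fin.last d) ⟹ sub' (Fin.last d) ((aIdx d h hd).castSucc))))
  else ⊥

/-- The list of formulas `xᵢ ≠ xⱼ` for `i < j < n`. -/
def distinctPairs (n : ℕ) : List (BF n) :=
  (List.finRange n).flatMap fun i => (List.finRange n).filterMap fun j =>
    if i.val < j.val then some (∼(eq' i j)) else none

/-- `ψ_{>n}` : there exist at least `n + 1` distinct atoms. -/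
def psiGt (n : ℕ) : Lmso.Sentence :=
  BoundedFormula.exs (n := n + 1)
    (bigAnd ((List.finRange (n + 1)).map fun i => at' i) ⊓ bigAnd (distinctPairs (n + 1)))

/-- `ψ_{=n}` : there exist exactly `n` distinct atoms. -/
def psiEq (n : ℕ) : Lmso.Sentence :=
  BoundedFormula.exs (n := n)
    (bigAnd ((List.finRange n).map fun i => at' i) ⊓ bigAnd (distinctPairs n) ⊓
      ∀' (at' (Fin.last n) ⟹ bigOr ((List.finRange n).map fun i => eq' (Fin.last n) i.castSucc)))

/-! ### Residue functions and the theories `T_r̃` -/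

/-- A residue function `ℙ × ℕ_{>0} → ℕ` (conditions imposed only at primes `p` and `j ≥ 1`):
`r(p,j) < p^j` and `r(p,j+1) ≡ r(p,j) [MOD p^j]`. -/
def IsResidueFunction (r : ℕ → ℕ → ℕ) : Prop :=
  ∀ p j : ℕ, p.Prime → 1 ≤ j → r p j < p ^ j ∧ r p (j + 1) ≡ r p j [MOD p ^ j]

/-- A function `ℕ_{>1} → ℕ` is a residue function if it arises from a residue function
`ℙ × ℕ_{>0} → ℕ` as in the paper (conditions imposed only for `d > 1`). -/
def IsResidueFunctionTilde (rt : ℕ → ℕ) : Prop :=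
  ∃ r : ℕ → ℕ → ℕ, IsResidueFunction r ∧
    ∀ d : ℕ, 1 < d → rt d < d ∧
      ∀ p j : ℕ, p.Prime → 1 ≤ j → p ^ j ∣ d → rt d ≡ r p j [MOD p ^ j]

/-- The theory `T_r̃ = T_MSO(Fin) ∪ {ψ_{>n} : n ∈ ℕ} ∪ {ρ_{d,r̃(d)} : d > 1}`. -/
def Trt (rt : ℕ → ℕ) : Lmso.Theory :=
  TMSOFin ∪ Set.range psiGt ∪ {σ : Lmso.Sentence | ∃ d : ℕ, 1 < d ∧ σ = rho d (rt d)}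

/-! ### Relativization and the sum of sentences -/

/-- Relativization of a formula to the elements `⊆ v`:
each quantifier `∀ Z (…)` becomes `∀ Z (Z ⊆ v → …)`. -/
def relv : ∀ {n : ℕ}, BF n → Fin n → BF n
  | _, BoundedFormula.falsum, _ => BoundedFormula.falsum
  | _, BoundedFormula.equal s t, _ => BoundedFormula.equal s t
  | _, BoundedFormula.rel r ts, _ => BoundedFormula.rel r ts
  | _, BoundedFormula.imp f g, v => (relv f v).imp (relv g v)
  | n, BoundedFormula.all f, v =>
      BoundedFormula.all (sub' (Fin.last n) v.castSucc ⟹ relv f v.castSucc)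

/-- `i` is downward closed with respect to the `≤ᴱ`-ordering of the atoms. -/
def dwcl' {n : ℕ} (i : Fin n) : BF n :=
  ∀' ∀' ((at' ((Fin.last n).castSucc) ⊓ at' (Fin.last (n + 1)) ⊓
      sub' ((Fin.last n).castSucc) (i.castSucc.castSucc) ⊓
      exle' (Fin.last (n + 1)) ((Fin.last n).castSucc)) ⟹
    sub' (Fin.last (n + 1)) (i.castSucc.castSucc))

/-- The sentence `φ + ψ` : `∃ X (X downward closed ∧ φ^X ∧ ψ^(Xᶜ))`
(with the complement `Xᶜ` introduced by an existential quantifier). -/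
def plusSent (φ ψ : Lmso.Sentence) : Lmso.Sentence :=
  ∃' ∃' (dwcl' (0 : Fin 2) ⊓ isComplOf (1 : Fin 2) (0 : Fin 2) ⊓
    relv (φ.liftAt 2 0) (0 : Fin 2) ⊓ relv (ψ.liftAt 2 0) (1 : Fin 2))

/-! ### `FSpec` and ultimate periodicity -/

/-- `FSpec φ` : the set of `n ∈ ℕ` such that `MSO(n) ⊨ φ`. -/
def FSpec (φ : Lmso.Sentence) : Set ℕ := {n : ℕ | MSOn n ⊨ φ}

/-- A set of naturals is ultimately periodic. -/
def UltPeriodic (S : Set ℕ) : Prop :=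
  ∃ N d : ℕ, 0 < d ∧ ∀ n : ℕ, N < n → (n ∈ S ↔ n + d ∈ S)

/-! ### The language `L_MO = {⊆, <}` -/

/-- The language `L_MO` with two binary relations: `⊆` (encoded `true`) and `<`
(encoded `false`). -/
def Lmo : Language where
  Functions := fun _ => Empty
  Relations := fun n => match n with | 2 => Bool | _ => Empty

/-- The monadic second order version `MSO(α)` of a linear order `α` as an `L_MO`-structure:
`⊆` is inclusion and `<` is the ordering of `α` on singletons. -/
instance moStructure (α : Type*) [LinearOrder α] : Lmo.Structure (Set α) where
  funMap := fun f _ => f.elim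
  RelMap := fun {n} r v => match n, r with
    | 2, true => v 0 ⊆ v 1
    | 2, false => ∃ a b : α, v 0 = {a} ∧ v 1 = {b} ∧ a < b

/-! ### Semantic content of the axioms -/

section Axioms

variable {M : Type*} [Lmso.Structure M]

@[simp] theorem realize_sub' {n : ℕ} (i j : Fin n) (v : Empty → M) (xs : Fin n → M) :
    (sub' i j).Realize v xs ↔ subE (xs i) (xs j) := by
  simp [sub', tv, subE]

@[simp] theorem realize_exle' {n : ℕ} (i j : Fin n) (v : Empty → M) (xs : Fin n → M) :
    (exle' i j).Realize v xs ↔ exleE (xs i) (xs j) := by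
  simp [exle', tv, exleE]

@[simp] theorem realize_at' {n : ℕ} (i : Fin n) (v : Empty → M) (xs : Fin n → M) :
    (at' i).Realize v xs ↔ atE (xs i) := by
  simp [at', tv, atE]

@[simp] theorem realize_eq' {n : ℕ} (i j : Fin n) (v : Empty → M) (xs : Fin n → M) :
    (eq' i j).Realize v xs ↔ xs i = xs j := by
  simp [eq', tv]

theorem realize_tb {n : ℕ} (v : Empty ⊕ Fin n → M) : (tb : Lmso.Term _).realize v = botE M := by
  rw [tb, Term.realize_constants, botE, ← funMap_eq_coe_constants]

@[simp] theorem realize_isBot' {n : ℕ} (i : Fin n) (v : Empty → M) (xs : Fin n → M) :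
    (isBot' i).Realize v xs ↔ xs i = botE M := by
  simp [isBot', tv, realize_tb]

@[simp] theorem realize_botSub' {n : ℕ} (i : Fin n) (v : Empty → M) (xs : Fin n → M) :
    (botSub' i).Realize v xs ↔ subE (botE M) (xs i) := by
  simp [botSub', tv, realize_tb, subE]

@[simp] theorem realize_bigAnd {n : ℕ} (l : List (BF n)) (v : Empty → M) (xs : Fin n → M) :
    (bigAnd l).Realize v xs ↔ ∀ φ ∈ l, φ.Realize v xs :=
  BoundedFormula.realize_foldr_inf l v xs

@[simp] theorem realize_bigOr {n : ℕ} (l : List (BF n)) (v : Empty → M) (xs : Fin n → M) :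
    (bigOr l).Realize v xs ↔ ∃ φ ∈ l, φ.Realize v xs :=
  BoundedFormula.realize_foldr_sup l v xs

variable [hM : M ⊨ TMSOFin]

theorem realize_of_mem_TMSOFin {φ : Lmso.Sentence} (h : φ ∈ TMSOFin) :
    BoundedFormula.Realize φ (default : Empty → M) default :=
  hM.realize_of_mem φ h

theorem subE_refl (x : M) : subE x x := by
  have h := realize_of_mem_TMSOFin (M := M) (φ := axRefl) (by simp [TMSOFin, Tbase])
  simp [axRefl, Fin.snoc] at h
  exact h x

theorem subE_antisymm {x y : M} (hxy : subE x y) (hyx : subE y x) : x = y := by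
  have h := realize_of_mem_TMSOFin (M := M) (φ := axAntisymm) (by simp [TMSOFin, Tbase])
  simp [axAntisymm, Fin.snoc] at h
  exact h x y hxy hyx

theorem subE_trans {x y z : M} (hxy : subE x y) (hyz : subE y z) : subE x z := by
  have h := realize_of_mem_TMSOFin (M := M) (φ := axTrans) (by simp [TMSOFin, Tbase])
  simp [axTrans, Fin.snoc] at h
  exact h x y z hxy hyz

theorem botE_subE (x : M) : subE (botE M) x := by
  have h := realize_of_mem_TMSOFin (M := M) (φ := axBotLe) (by simp [TMSOFin, Tbase])
  simp [axBotLe, Fin.snoc] at h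
  exact h x

theorem exists_meet (x y : M) :
    ∃ z, subE z x ∧ subE z y ∧ ∀ w, subE w x → subE w y → subE w z := by
  have h := realize_of_mem_TMSOFin (M := M) (φ := axMeet) (by simp [TMSOFin, Tbase])
  simp [axMeet, isMeet, Fin.snoc] at h
  obtain ⟨z, h1, h2⟩ := h x y
  exact ⟨z, h1.1, h1.2, h2⟩

theorem exists_join (x y : M) :
    ∃ z, subE x z ∧ subE y z ∧ ∀ w, subE x w → subE y w → subE z w := by
  have h := realize_of_mem_TMSOFin (M := M) (φ := axJoin) (by simp [TMSOFin, Tbase])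
  simp [axJoin, isJoin, Fin.snoc] at h
  obtain ⟨z, h1, h2⟩ := h x y
  exact ⟨z, h1.1, h1.2, h2⟩

theorem exists_compl (x : M) :
    ∃ y, (∀ w, subE w x → subE w y → w = botE M) ∧
      ∀ w, subE x w → subE y w → ∀ z, subE z w := by
  have h := realize_of_mem_TMSOFin (M := M) (φ := axCompl) (by simp [TMSOFin, Tbase])
  simp [axCompl, isComplOf, meetIsBot, joinIsTop, Fin.snoc] at h
  obtain ⟨y, h1, h2⟩ := h x
  exact ⟨y, h1, h2⟩

theorem meet_join_subE (a b c d e f g k : M)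
    (hd : subE d a ∧ subE d b ∧ ∀ w, subE w a → subE w b → subE w d)
    (he : subE e a ∧ subE e c ∧ ∀ w, subE w a → subE w c → subE w e)
    (hf : subE b f ∧ subE c f ∧ ∀ w, subE b w → subE c w → subE f w)
    (hg : subE g a ∧ subE g f ∧ ∀ w, subE w a → subE w f → subE w g)
    (hk : subE d k ∧ subE e k ∧ ∀ w, subE d w → subE e w → subE k w) : subE g k := by
  have h := realize_of_mem_TMSOFin (M := M) (φ := axDistrib) (by simp [TMSOFin, Tbase])
  simp [axDistrib, isMeet, isJoin, Fin.snoc, -imp_false] at h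
  have := h a b c d e f g k
  tauto

theorem atE_iff (x : M) :
    atE x ↔ x ≠ botE M ∧ ∀ y, subE y x → y = botE M ∨ y = x := by
  have h := realize_of_mem_TMSOFin (M := M) (φ := axAt) (by simp [TMSOFin, Tbase])
  simp [axAt, isAtomDef, Fin.snoc] at h
  exact h x

theorem exists_atE_subE {x : M} (hx : x ≠ botE M) : ∃ a, atE a ∧ subE a x := by
  have h := realize_of_mem_TMSOFin (M := M) (φ := axAtomic) (by simp [TMSOFin, Tbase])
  simp [axAtomic, Fin.snoc] at h
  exact h x hx

theorem exleE_irrefl {a : M} (ha : atE a) : ¬ exleE a a := by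
  have h := realize_of_mem_TMSOFin (M := M) (φ := axIrrefl) (by simp [TMSOFin, Tbase])
  simp [axIrrefl, Fin.snoc] at h
  exact h a ha

theorem exleE_trans {a b c : M} (ha : atE a) (hb : atE b) (hc : atE c)
    (hab : exleE a b) (hbc : exleE b c) : exleE a c := by
  have h := realize_of_mem_TMSOFin (M := M) (φ := axTransAt) (by simp [TMSOFin, Tbase])
  simp [axTransAt, Fin.snoc] at h
  exact h a b c ha hb hc hab hbc

theorem exleE_trichotomy {a b : M} (ha : atE a) (hb : atE b) :
    exleE a b ∨ a = b ∨ exleE b a := by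
  have h := realize_of_mem_TMSOFin (M := M) (φ := axTrich) (by simp [TMSOFin, Tbase])
  simp [axTrich, Fin.snoc] at h
  have := h a b ha hb
  tauto

theorem exleE_iff (x y : M) :
    exleE x y ↔ ∃ a b, atE a ∧ atE b ∧ subE a x ∧ subE b y ∧ exleE a b := by
  have h := realize_of_mem_TMSOFin (M := M) (φ := axExleDef) (by simp [TMSOFin, Tbase])
  simp [axExleDef, Fin.snoc] at h
  rw [h x y]
  simp only [and_assoc]

theorem exists_greatest_atE (h₀ : ∃ a : M, atE a) :
    ∃ a : M, atE a ∧ ∀ b, atE b → ¬ exleE a b := by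
  have h := realize_of_mem_TMSOFin (M := M) (φ := axGreatestAtom) (by simp [TMSOFin, Tbase])
  simp [axGreatestAtom, isGreatestAtom, Fin.snoc] at h
  exact h _ h₀.choose_spec

theorem exists_succ_atE {a b : M} (ha : atE a) (hb : atE b) (hab : exleE a b) :
    ∃ c, atE c ∧ exleE a c ∧ ∀ x, atE x → exleE a x → x = c ∨ exleE c x := by
  have h := realize_of_mem_TMSOFin (M := M) (φ := axSucc) (by simp [TMSOFin, Tbase])
  simp [axSucc, isSuccOf, Fin.snoc] at h
  obtain ⟨c, h1, h2⟩ := h a ha b hb hab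
  exact ⟨c, h1.1.2, h1.2, h2⟩

theorem exists_pred_atE {a b : M} (ha : atE a) (hb : atE b) (hab : exleE b a) :
    ∃ c, atE c ∧ exleE c a ∧ ∀ x, atE x → exleE c x → x = a ∨ exleE a x := by
  have h := realize_of_mem_TMSOFin (M := M) (φ := axPred) (by simp [TMSOFin, Tbase])
  simp [axPred, isSuccOf, Fin.snoc] at h
  obtain ⟨c, h1, h2⟩ := h a ha b hb hab
  exact ⟨c, h1.1.1, h1.2, h2⟩

theorem exists_least_atE_subE {x : M} (hx : x ≠ botE M) :
    ∃ a, atE a ∧ subE a x ∧ ∀ b, atE b → subE b x → ¬ exleE b a := by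
  have h := realize_of_mem_TMSOFin (M := M) (φ := axLeastIn) (by simp [TMSOFin, Tbase])
  simp [axLeastIn, Fin.snoc] at h
  obtain ⟨a, h1, h2⟩ := h x hx
  exact ⟨a, h1.1, h1.2, h2⟩

theorem exists_comprehension {n : ℕ} (η : BF (n + 1)) (Y : Fin n → M) :
    ∃ X : M, ∀ a, atE a → (subE a X ↔ η.Realize default (Fin.snoc Y a)) := by
  have h := realize_of_mem_TMSOFin (M := M) (φ := compAx η)
    (Or.inl (Or.inr (Set.mem_iUnion.2 ⟨n, η, rfl⟩)))
  obtain ⟨X, hX⟩ := BoundedFormula.realize_ex.1 (BoundedFormula.realize_alls.1 h Y)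
  refine ⟨X, fun a ha => ?_⟩
  have := hX a
  simp only [BoundedFormula.realize_imp, realize_at', Fin.snoc_last, BoundedFormula.realize_iff,
    realize_sub', Fin.snoc_castSucc, ha, true_imp_iff] at this
  rw [this, BoundedFormula.realize_liftAt_one (by omega)]
  apply iff_of_eq
  congr 1
  funext i
  refine Fin.lastCases ?_ (fun j => ?_) i
  · simp [Fin.snoc]
  · simp [Fin.snoc]
    
theorem not_subE_botE {a : M} (ha : atE a) : ¬ subE a (botE M) := fun h =>
  ((atE_iff a).1 ha).1 (subE_antisymm h (botE_subE a))

theorem subE_iff_forall_atE {x y : M} : subE x y ↔ ∀ a, atE a → subE a x → subE a y := by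
  refine ⟨fun h _ _ hax => subE_trans hax h, fun h => ?_⟩
  obtain ⟨z, hz, hz'⟩ := exists_compl y
  obtain ⟨d, hd⟩ := exists_meet x y
  obtain ⟨e, he⟩ := exists_meet x z
  obtain ⟨f, hf⟩ := exists_join y z
  obtain ⟨g, hg⟩ := exists_meet x f
  obtain ⟨k, hk⟩ := exists_join d e
  have hgk := meet_join_subE x y z d e f g k hd he hf hg hk
  have hxg : subE x g := hg.2.2 x (subE_refl x) (hz' f hf.1 hf.2.1 x)
  have heb : e = botE M := by
    by_contra hne
    obtain ⟨a, ha, hae⟩ := exists_atE_subE hne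
    have := hz a (h a ha (subE_trans hae he.1)) (subE_trans hae he.2.1)
    exact ((atE_iff a).1 ha).1 this
  exact subE_trans (subE_trans hxg hgk) (hk.2.2 y hd.2.1 (heb ▸ botE_subE y))

theorem eq_iff_forall_atE {x y : M} : x = y ↔ ∀ a, atE a → (subE a x ↔ subE a y) :=
  ⟨fun h _ _ => h ▸ Iff.rfl, fun h => subE_antisymm
    (subE_iff_forall_atE.2 fun a ha => (h a ha).1) (subE_iff_forall_atE.2 fun a ha => (h a ha).2)⟩

theorem subE_atE_iff {a b : M} (ha : atE a) (hb : atE b) : subE a b ↔ a = b := by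
  refine ⟨fun h => ?_, fun h => h ▸ subE_refl a⟩
  rcases ((atE_iff b).1 hb).2 a h with h | h
  · exact absurd h ((atE_iff a).1 ha).1
  · exact h

end Axioms

/-! ### Definable relations -/

section Definability

variable {M : Type*} [Lmso.Structure M] {α : Type*}

/-- A relation on `M` is definable without parameters. -/
def Dfn (P : (α → M) → Prop) : Prop := ∃ φ : Lmso.Formula α, ∀ v, φ.Realize v ↔ P v

theorem Dfn.congr {P Q : (α → M) → Prop} (h : Dfn P) (hPQ : ∀ v, P v ↔ Q v) : Dfn Q := by
  obtain ⟨φ, hφ⟩ := h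
  exact ⟨φ, fun v => (hφ v).trans (hPQ v)⟩

theorem Dfn.const (p : Prop) : Dfn (fun _ : α → M => p) := by
  by_cases h : p
  · exact ⟨⊤, fun v => by simp [h]⟩
  · exact ⟨⊥, fun v => by simp [h]⟩

theorem Dfn.not {P : (α → M) → Prop} (h : Dfn P) : Dfn (fun v => ¬ P v) := by
  obtain ⟨φ, hφ⟩ := h
  exact ⟨φ.not, fun v => by rw [Formula.realize_not, hφ]⟩

theorem Dfn.and {P Q : (α → M) → Prop} (h : Dfn P) (h' : Dfn Q) : Dfn (fun v => P v ∧ Q v) := by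
  obtain ⟨φ, hφ⟩ := h
  obtain ⟨ψ, hψ⟩ := h'
  exact ⟨φ ⊓ ψ, fun v => by rw [Formula.realize_inf, hφ, hψ]⟩

theorem Dfn.iff {P Q : (α → M) → Prop} (h : Dfn P) (h' : Dfn Q) : Dfn (fun v => P v ↔ Q v) := by
  obtain ⟨φ, hφ⟩ := h
  obtain ⟨ψ, hψ⟩ := h'
  exact ⟨φ.iff ψ, fun v => by rw [Formula.realize_iff, hφ, hψ]⟩

theorem Dfn.finite_forall {ι : Type*} [Finite ι] {P : ι → (α → M) → Prop} (h : ∀ i, Dfn (P i)) :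
    Dfn (fun v => ∀ i, P i v) := by
  choose φ hφ using h
  exact ⟨Formula.iInf φ, fun v => by rw [Formula.realize_iInf]; simp only [hφ]⟩

theorem Dfn.finite_exists {ι : Type*} [Finite ι] {P : ι → (α → M) → Prop} (h : ∀ i, Dfn (P i)) :
    Dfn (fun v => ∃ i, P i v) := by
  choose φ hφ using h
  exact ⟨Formula.iSup φ, fun v => by rw [Formula.realize_iSup]; simp only [hφ]⟩

/-- Definability is preserved by arbitrary propositional functions of finitely many
arguments. -/
theorem Dfn.propositional {ι : Type*} [Finite ι] {P : ι → (α → M) → Prop} (h : ∀ i, Dfn (P i))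
    (f : (ι → Prop) → Prop) : Dfn (fun v => f (fun i => P i v)) := by
  have : Dfn (fun v => ∃ l : ι → Prop, f l ∧ ∀ i, (P i v ↔ l i)) :=
    Dfn.finite_exists fun l => (Dfn.const _).and
      (Dfn.finite_forall fun i => (h i).iff (Dfn.const _))
  refine this.congr fun v => ⟨?_, fun hf => ⟨_, hf, fun i => Iff.rfl⟩⟩
  rintro ⟨l, hl, hi⟩
  rwa [show (fun i => P i v) = l from funext fun i => propext (hi i)]

theorem Dfn.exists {P : (α → M) → M → Prop}
    (h : Dfn (fun w : α ⊕ Unit → M => P (w ∘ Sum.inl) (w (Sum.inr ())))) :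
    Dfn (fun v => ∃ y, P v y) := by
  obtain ⟨φ, hφ⟩ := h
  refine ⟨φ.iExs Unit, fun v => ?_⟩
  rw [Formula.realize_iExs]
  simp only [hφ]
  exact ⟨fun ⟨i, hi⟩ => ⟨_, hi⟩, fun ⟨y, hy⟩ => ⟨fun _ => y, hy⟩⟩

theorem Dfn.comp {β : Type*} {P : (α → M) → Prop} (h : Dfn P) (g : α → β) :
    Dfn (fun v : β → M => P (v ∘ g)) := by
  obtain ⟨φ, hφ⟩ := h
  exact ⟨φ.relabel g, fun v => by rw [Formula.realize_relabel, hφ]⟩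

theorem Dfn.subE (i j : α) : Dfn (fun v : α → M => subE (v i) (v j)) :=
  ⟨subR.formula₂ (Term.var i) (Term.var j), fun v => by simp [MSO.subE]⟩

theorem Dfn.exleE (i j : α) : Dfn (fun v : α → M => exleE (v i) (v j)) :=
  ⟨exleR.formula₂ (Term.var i) (Term.var j), fun v => by simp [MSO.exleE]⟩

theorem Dfn.atE (i : α) : Dfn (fun v : α → M => atE (v i)) :=
  ⟨atR.formula₁ (Term.var i), fun v => by simp [MSO.atE]⟩

end Definability

/-! ### The ordered set of atoms and its internal subsets -/

section Atoms

/-- The atoms of an `L_⊗`-structure. -/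
def Atom (M : Type*) [Lmso.Structure M] : Type _ := {a : M // atE a}

instance (M : Type*) [Lmso.Structure M] : CoeOut (Atom M) M := ⟨Subtype.val⟩

variable {M : Type*} [Lmso.Structure M] [M ⊨ TMSOFin]

noncomputable instance : LinearOrder (Atom M) where
  le a b := ¬ exleE (b : M) a
  lt a b := exleE (a : M) b
  le_refl a := exleE_irrefl a.2
  le_trans a b c hab hbc hca := by
    rcases exleE_trichotomy a.2 b.2 with h | h | h
    · exact hbc (exleE_trans c.2 a.2 b.2 hca h)
    · exact hbc (h ▸ hca)
    · exact hab h
  lt_iff_le_not_ge a b := by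
    refine ⟨fun h => ⟨fun h' => ?_, not_not.2 h⟩, fun h => not_not.1 h.2⟩
    exact exleE_irrefl a.2 (exleE_trans a.2 b.2 a.2 h h')
  le_antisymm a b hab hba := by
    rcases exleE_trichotomy a.2 b.2 with h | h | h
    · exact absurd h hba
    · exact Subtype.ext h
    · exact absurd h hab
  le_total a b := by
    by_contra! h
    exact exleE_irrefl a.2 (exleE_trans a.2 b.2 a.2 h.2 h.1)
  toDecidableLE := Classical.decRel _

theorem Atom.ext_iff_subE {a b : Atom M} : a = b ↔ subE (a : M) b := by
  rw [subE_atE_iff a.2 b.2]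
  exact Subtype.ext_iff

theorem Atom.subE_iff {x y : M} : subE x y ↔ ∀ a : Atom M, subE (a : M) x → subE (a : M) y := by
  rw [subE_iff_forall_atE]
  exact ⟨fun h a => h a.1 a.2, fun h a ha => h ⟨a, ha⟩⟩

theorem Atom.eq_iff {x y : M} : x = y ↔ ∀ a : Atom M, subE (a : M) x ↔ subE (a : M) y := by
  rw [eq_iff_forall_atE]
  exact ⟨fun h a => h a.1 a.2, fun h a ha => h ⟨a, ha⟩⟩

theorem Atom.exleE_iff {x y : M} :
    exleE x y ↔ ∃ b c : Atom M, b < c ∧ subE (b : M) x ∧ subE (c : M) y := by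
  rw [MSO.exleE_iff]
  constructor
  · rintro ⟨a, b, ha, hb, hax, hby, hab⟩
    exact ⟨⟨a, ha⟩, ⟨b, hb⟩, hab, hax, hby⟩
  · rintro ⟨a, b, hab, hax, hby⟩
    exact ⟨a, b, a.2, b.2, hax, hby, hab⟩

theorem Atom.ne_botE_iff {x : M} : x ≠ botE M ↔ ∃ a : Atom M, subE (a : M) x := by
  refine ⟨fun h => ?_, ?_⟩
  · obtain ⟨a, ha, hax⟩ := exists_atE_subE h
    exact ⟨⟨a, ha⟩, hax⟩
  · rintro ⟨a, ha⟩ rfl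
    exact not_subE_botE a.2 ha

theorem Atom.atE_iff {x : M} :
    MSO.atE x ↔ (∃ a : Atom M, subE (a : M) x) ∧
      ¬ ∃ b c : Atom M, b < c ∧ subE (b : M) x ∧ subE (c : M) x := by
  constructor
  · intro hx
    refine ⟨⟨⟨x, hx⟩, subE_refl x⟩, ?_⟩
    rintro ⟨b, c, hbc, hb, hc⟩
    rw [subE_atE_iff b.2 hx] at hb
    rw [subE_atE_iff c.2 hx] at hc
    exact hbc.ne (Subtype.ext (hb.trans hc.symm))
  · rintro ⟨⟨a, ha⟩, h⟩
    have : x = a := Atom.eq_iff.2 fun c => by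
      rw [← Atom.ext_iff_subE]
      refine ⟨fun hc => ?_, fun hc => hc ▸ ha⟩
      by_contra hne
      rcases lt_or_gt_of_ne hne with h' | h'
      exacts [h ⟨_, _, h', hc, ha⟩, h ⟨_, _, h', ha, hc⟩]
    rw [this]
    exact a.2

/-- A set of atoms is internal if it is the set of atoms below some element. -/
def Internal (U : Set (Atom M)) : Prop := ∃ X : M, ∀ a : Atom M, subE (a : M) X ↔ a ∈ U

theorem Dfn.internal {n : ℕ} {P : (Fin n ⊕ Unit → M) → Prop} (h : Dfn P) (Y : Fin n → M) :
    Internal {a : Atom M | P (Sum.elim Y (fun _ => (a : M)))} := by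
  obtain ⟨φ, hφ⟩ := h.comp (Sum.elim Fin.castSucc (fun _ => Fin.last n))
  obtain ⟨X, hX⟩ := exists_comprehension
    (BoundedFormula.relabel (Sum.inr : Fin (n + 1) → Empty ⊕ Fin (n + 1)) φ : BF (n + 1)) Y
  refine ⟨X, fun a => (hX a a.2).trans ?_⟩
  refine (Formula.realize_relabel_sumInr φ).trans ((hφ _).trans (iff_of_eq ?_))
  simp only [Set.mem_ofPred_eq]
  congr 1
  funext i
  rcases i with i | i <;> simp

theorem internal_propositional {ι : Type*} [Finite ι] {U : ι → Set (Atom M)}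
    (hU : ∀ i, Internal (U i)) (f : (ι → Prop) → Prop) : Internal {a | f (fun i => a ∈ U i)} := by
  choose X hX using hU
  obtain ⟨n, ⟨e⟩⟩ := Finite.exists_equiv_fin ι
  have := Dfn.internal (n := n) (Dfn.propositional (ι := ι)
    (P := fun i (w : Fin n ⊕ Unit → M) => subE (w (Sum.inr ())) (w (Sum.inl (e i))))
    (fun i => Dfn.subE _ _) f) (X ∘ e.symm)
  simpa [hX] using this

theorem Internal.compl {U : Set (Atom M)} (h : Internal U) : Internal Uᶜ :=
  internal_propositional (ι := Unit) (U := fun _ => U) (fun _ => h) (fun p => ¬ p ())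

theorem Internal.inter {U V : Set (Atom M)} (h : Internal U) (h' : Internal V) :
    Internal (U ∩ V) :=
  internal_propositional (ι := Bool) (U := fun b => cond b U V) (Bool.rec h' h)
    (fun p => p true ∧ p false)

theorem Internal.union {U V : Set (Atom M)} (h : Internal U) (h' : Internal V) :
    Internal (U ∪ V) :=
  internal_propositional (ι := Bool) (U := fun b => cond b U V) (Bool.rec h' h)
    (fun p => p true ∨ p false)

theorem Internal.iUnion {ι : Type*} [Finite ι] {U : ι → Set (Atom M)} (h : ∀ i, Internal (U i)) :
    Internal (⋃ i, U i) := by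
  rw [show ⋃ i, U i = {a | ∃ i, a ∈ U i} by ext; simp]
  exact internal_propositional h (fun p => ∃ i, p i)

theorem internal_Iic (b : Atom M) : Internal (Set.Iic b) := by
  have := Dfn.internal (n := 1) (Dfn.exleE (M := M) (Sum.inl 0) (Sum.inr ())).not (fun _ => b.1)
  exact this

theorem internal_singleton (b : Atom M) : Internal {b} :=
  ⟨b, fun _ => Atom.ext_iff_subE.symm⟩

theorem internal_empty : Internal (∅ : Set (Atom M)) :=
  ⟨botE M, fun a => by simpa using not_subE_botE a.2⟩

theorem Internal.exists_least {U : Set (Atom M)} (h : Internal U) (hne : U.Nonempty) :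
    ∃ a, IsLeast U a := by
  obtain ⟨X, hX⟩ := h
  obtain ⟨b, hb⟩ := hne
  obtain ⟨a, ha, haX, hmin⟩ := exists_least_atE_subE
    (Atom.ne_botE_iff.2 ⟨b, (hX b).2 hb⟩)
  exact ⟨⟨a, ha⟩, (hX ⟨a, ha⟩).1 haX, fun c hc => hmin c c.2 ((hX c).2 hc)⟩

theorem Atom.exists_isMax [Nonempty (Atom M)] : ∃ a : Atom M, IsMax a := by
  obtain ⟨b⟩ := ‹Nonempty (Atom M)›
  obtain ⟨a, ha, h⟩ := exists_greatest_atE ⟨b.1, b.2⟩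
  exact ⟨⟨a, ha⟩, fun c _ => h c c.2⟩

theorem Atom.exists_covBy_right {a : Atom M} (h : ¬ IsMax a) : ∃ b, a ⋖ b := by
  obtain ⟨b, hb⟩ := not_isMax_iff.1 h
  obtain ⟨c, hc, hac, h⟩ := exists_succ_atE a.2 b.2 hb
  refine ⟨⟨c, hc⟩, hac, fun x hax hxc => ?_⟩
  rcases h x x.2 hax with h | h
  · exact hxc.ne (Subtype.ext h)
  · exact lt_asymm hxc h

theorem Atom.exists_covBy_left {a : Atom M} (h : ¬ IsMin a) : ∃ b, b ⋖ a := by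
  obtain ⟨b, hb⟩ := not_isMin_iff.1 h
  obtain ⟨c, hc, hca, h⟩ := exists_pred_atE a.2 b.2 hb
  refine ⟨⟨c, hc⟩, hca, fun x hcx hxa => ?_⟩
  rcases h x x.2 hcx with h | h
  · exact hxa.ne (Subtype.ext h)
  · exact lt_asymm hxa h

/-- Induction along the atoms, for internal sets, from a starting point `a₀`. -/
theorem Internal.induction_Ici {U : Set (Atom M)} (hU : Internal U) (a₀ : Atom M) (h₀ : a₀ ∈ U)
    (hs : ∀ a b, a₀ ≤ a → a ⋖ b → a ∈ U → b ∈ U) {a : Atom M} (ha : a₀ ≤ a) : a ∈ U := by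
  by_contra hnot
  have hI : Internal ({c | a₀ ≤ c} ∩ Uᶜ) := by
    refine Internal.inter ?_ hU.compl
    exact Dfn.internal (n := 1) (Dfn.exleE (M := M) (Sum.inr ()) (Sum.inl 0)).not (fun _ => a₀.1)
  obtain ⟨b, ⟨hb, hbU⟩, hmin⟩ := hI.exists_least ⟨a, ha, hnot⟩
  have hlt : a₀ < b := lt_of_le_of_ne hb (by rintro rfl; exact hbU h₀)
  obtain ⟨c, hc⟩ := Atom.exists_covBy_left (a := b) (not_isMin_iff.2 ⟨_, hlt⟩)
  have hac : a₀ ≤ c := le_of_not_gt fun h => hc.2 h hlt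
  by_cases hcU : c ∈ U
  · exact hbU (hs c b hac hc hcU)
  · exact not_lt_of_ge (hmin ⟨hac, hcU⟩) hc.lt

theorem Atom.exists_isMin [Nonempty (Atom M)] : ∃ a : Atom M, IsMin a := by
  obtain ⟨a, -, ha⟩ := (internal_empty (M := M)).compl.exists_least (by simp)
  exact ⟨a, fun b _ => ha (by simp)⟩

/-- Induction along all atoms, for internal sets. -/
theorem Internal.induction {U : Set (Atom M)} (hU : Internal U) (h₀ : ∀ a, IsMin a → a ∈ U)
    (hs : ∀ a b, a ⋖ b → a ∈ U → b ∈ U) (a : Atom M) : a ∈ U := by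
  have : Nonempty (Atom M) := ⟨a⟩
  obtain ⟨m, hm⟩ := Atom.exists_isMin (M := M)
  exact hU.induction_Ici m (h₀ m hm) (fun a b _ => hs a b) (hm.isBot a)

end Atoms

/-! ### Runs of finite automata along the atoms -/

section Runs

/-- The letter read at `a`: which of the `X i` contain `a`. -/
def letter {M : Type*} [Lmso.Structure M] {n : ℕ} (X : Fin n → M) (a : M) : Fin n → Prop :=
  fun i => subE a (X i)

theorem Dfn.letter {M : Type*} [Lmso.Structure M] {n : ℕ} {α : Type*} (g : Fin n → α) (i : α)
    (f : (Fin n → Prop) → Prop) :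
    Dfn (fun w : α → M => f (letter (w ∘ g) (w i))) :=
  Dfn.propositional (P := fun k (w : α → M) => MSO.subE (w i) (w (g k)))
    (fun _ => Dfn.subE _ _) f

variable {M : Type*} [Lmso.Structure M] [M ⊨ TMSOFin] {n : ℕ} {σ : Type*}

/-- `r` is a run of the automaton `D` along the atoms of `M`, on the word coded by `X`. -/
structure IsRun (D : DFA (Fin n → Prop) σ) (X : Fin n → M) (r : Atom M → σ) : Prop where
  of_isMin : ∀ a, IsMin a → r a = D.step D.start (letter X a)
  of_covBy : ∀ a b, a ⋖ b → r b = D.step (r a) (letter X b)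

open Classical in
/-- The last state of a run. -/
noncomputable def finalState (D : DFA (Fin n → Prop) σ) (r : Atom M → σ) : σ :=
  if h : ∃ a : Atom M, IsMax a then r h.choose else D.start

theorem finalState_of_isEmpty [IsEmpty (Atom M)] (D : DFA (Fin n → Prop) σ) (r : Atom M → σ) :
    finalState D r = D.start :=
  dif_neg fun ⟨a, _⟩ => isEmptyElim a

theorem finalState_of_isMax {a : Atom M} (ha : IsMax a) (D : DFA (Fin n → Prop) σ)
    (r : Atom M → σ) : finalState D r = r a := by
  have h : ∃ a : Atom M, IsMax a := ⟨a, ha⟩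
  rw [finalState, dif_pos h]
  exact congrArg r ((ha.isTop _).antisymm (h.choose_spec.isTop _))

theorem Internal.preimage {r : Atom M → σ} [Finite σ] (h : ∀ q, Internal (r ⁻¹' {q}))
    (S : Set σ) : Internal (r ⁻¹' S) := by
  rw [show r ⁻¹' S = ⋃ q : S, r ⁻¹' {q.1} by ext; simp]
  exact Internal.iUnion fun q => h q

theorem internal_eq [Finite σ] {r r' : Atom M → σ} (h : ∀ q, Internal (r ⁻¹' {q}))
    (h' : ∀ q, Internal (r' ⁻¹' {q})) : Internal {a | r a = r' a} := by
  rw [show {a | r a = r' a} = ⋃ q, (r ⁻¹' {q} ∩ r' ⁻¹' {q}) by ext; simp [eq_comm] ]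
  exact Internal.iUnion fun q => (h q).inter (h' q)

/-- Internal runs agree as long as the words they read agree. -/
theorem IsRun.eq_of_forall_le [Finite σ] {D : DFA (Fin n → Prop) σ} {X X' : Fin n → M}
    {r r' : Atom M → σ} (hr : IsRun D X r) (hr' : IsRun D X' r')
    (h : ∀ q, Internal (r ⁻¹' {q})) (h' : ∀ q, Internal (r' ⁻¹' {q})) (c : Atom M)
    (hXX' : ∀ a ≤ c, letter X (a : M) = letter X' (a : M)) : r c = r' c := by
  have hI := (internal_Iic c).compl.union (internal_eq h h')
  have key : ∀ a, a ∈ (Set.Iic c)ᶜ ∪ {a | r a = r' a} := by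
    refine hI.induction (fun a ha => ?_) (fun a b hab ih => ?_)
    · by_cases hac : a ≤ c
      · right
        change r a = r' a
        rw [hr.of_isMin a ha, hr'.of_isMin a ha, hXX' a hac]
      · exact Or.inl hac
    · by_cases hbc : b ≤ c
      · right
        have hra : r a = r' a := ih.resolve_left fun h => h (hab.le.trans hbc)
        change r b = r' b
        rw [hr.of_covBy a b hab, hr'.of_covBy a b hab, hXX' b hbc, hra]
      · exact Or.inl hbc
  exact (key c).resolve_left fun h => h (le_refl c)

/-- A uniformly definable choice of runs of `D`, one for each word `X`. -/
structure IsRunFamily (D : DFA (Fin n → Prop) σ) (r : (Fin n → M) → M → σ) : Prop where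
  dfn : ∀ q, Dfn (fun w : Fin n ⊕ Unit → M => r (w ∘ Sum.inl) (w (Sum.inr ())) = q)
  isRun : ∀ X, IsRun D X (fun a : Atom M => r X a)

theorem IsRunFamily.internal {D : DFA (Fin n → Prop) σ} {r : (Fin n → M) → M → σ}
    (h : IsRunFamily D r) (X : Fin n → M) (q : σ) :
    Internal ((fun a : Atom M => r X a) ⁻¹' {q}) :=
  (h.dfn q).internal X

/-- The automaton that detects a letter in `f`, and a letter in `f` followed by a letter
in `g`. -/
def pairDFA (f g : (Fin n → Prop) → Prop) (acc : Set (Prop × Prop)) :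
    DFA (Fin n → Prop) (Prop × Prop) where
  step q l := (q.1 ∨ f l, q.2 ∨ (q.1 ∧ g l))
  start := (False, False)
  accept := acc

/-- The runs of `pairDFA`. -/
def pairRun (M : Type*) [Lmso.Structure M] (f g : (Fin n → Prop) → Prop) (X : Fin n → M) (a : M) :
    Prop × Prop :=
  (∃ b, (atE b ∧ ¬ exleE a b) ∧ f (letter X b),
    ∃ b c, (((atE b ∧ atE c) ∧ exleE b c) ∧ ¬ exleE a c) ∧ f (letter X b) ∧ g (letter X c))

theorem pairRun_atom (f g : (Fin n → Prop) → Prop) (X : Fin n → M) (a : Atom M) :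
    pairRun M f g X a = (∃ b : Atom M, b ≤ a ∧ f (letter X b),
      ∃ b c : Atom M, b < c ∧ c ≤ a ∧ f (letter X b) ∧ g (letter X c)) := by
  refine Prod.ext (propext ⟨?_, ?_⟩) (propext ⟨?_, ?_⟩)
  · rintro ⟨b, ⟨hb, h⟩, hf⟩
    exact ⟨⟨b, hb⟩, h, hf⟩
  · rintro ⟨b, h, hf⟩
    exact ⟨b, ⟨b.2, h⟩, hf⟩
  · rintro ⟨b, c, ⟨⟨⟨hb, hc⟩, hbc⟩, h⟩, hf, hg⟩
    exact ⟨⟨b, hb⟩, ⟨c, hc⟩, hbc, h, hf, hg⟩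
  · rintro ⟨b, c, hbc, h, hf, hg⟩
    exact ⟨b, c, ⟨⟨⟨b.2, c.2⟩, hbc⟩, h⟩, hf, hg⟩

theorem isRunFamily_pairRun (f g : (Fin n → Prop) → Prop) (acc : Set (Prop × Prop)) :
    IsRunFamily (pairDFA f g acc) (pairRun M f g) where
  dfn q := by
    have h₁ : Dfn (fun w : Fin n ⊕ Unit → M => (pairRun M f g (w ∘ Sum.inl) (w (Sum.inr ()))).1) :=
      Dfn.exists (((Dfn.atE (Sum.inr ())).and
        (Dfn.exleE (Sum.inl (Sum.inr ())) (Sum.inr ())).not).and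
        (Dfn.letter (fun k => Sum.inl (Sum.inl k)) (Sum.inr ()) f))
    have h₂ : Dfn (fun w : Fin n ⊕ Unit → M => (pairRun M f g (w ∘ Sum.inl) (w (Sum.inr ()))).2) :=
      Dfn.exists (Dfn.exists (((((Dfn.atE (Sum.inl (Sum.inr ()))).and (Dfn.atE (Sum.inr ()))).and
        (Dfn.exleE (Sum.inl (Sum.inr ())) (Sum.inr ()))).and
        (Dfn.exleE (Sum.inl (Sum.inl (Sum.inr ()))) (Sum.inr ())).not).and
        ((Dfn.letter (fun k => Sum.inl (Sum.inl (Sum.inl k))) (Sum.inl (Sum.inr ())) f).and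
        (Dfn.letter (fun k => Sum.inl (Sum.inl (Sum.inl k))) (Sum.inr ()) g))))
    exact ((h₁.iff (Dfn.const q.1)).and (h₂.iff (Dfn.const q.2))).congr fun w => by
      rw [Prod.ext_iff, ← iff_eq_eq, ← iff_eq_eq]
  isRun X := by
    constructor
    · intro a ha
      have h : ∀ b, b ≤ a ↔ b = a := fun b => ⟨ha.eq_of_le, fun h => h.le⟩
      have hlt : ∀ b, ¬ b < a := fun b => ha.not_lt
      rw [pairRun_atom]
      refine Prod.ext (propext ?_) (propext ?_)
      · simp [pairDFA, h]
      · simp only [pairDFA, h]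
        constructor
        · rintro ⟨b, c, hbc, rfl, -⟩
          exact absurd hbc (hlt _)
        · rintro (h | ⟨h, -⟩) <;> exact h.elim
    · intro a b hab
      have h : ∀ c, c ≤ b ↔ c ≤ a ∨ c = b := fun c => by
        rw [← hab.lt_iff_le_left, le_iff_lt_or_eq]
      rw [pairRun_atom, pairRun_atom]
      refine Prod.ext (propext ?_) (propext ?_)
      · simp only [pairDFA, h]
        constructor
        · rintro ⟨c, hc | rfl, hf⟩
          exacts [Or.inl ⟨c, hc, hf⟩, Or.inr hf]
        · rintro (⟨c, hc, hf⟩ | hf)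
          exacts [⟨c, Or.inl hc, hf⟩, ⟨b, Or.inr rfl, hf⟩]
      · simp only [pairDFA, h]
        constructor
        · rintro ⟨c, d, hcd, hd | rfl, hf, hg⟩
          exacts [Or.inl ⟨c, d, hcd, hd, hf, hg⟩, Or.inr ⟨⟨c, hab.lt_iff_le_left.1 hcd, hf⟩, hg⟩]
        · rintro (⟨c, d, hcd, hd, hf, hg⟩ | ⟨⟨c, hc, hf⟩, hg⟩)
          exacts [⟨c, d, hcd, Or.inl hd, hf, hg⟩,
            ⟨c, b, hab.lt_iff_le_left.2 hc, Or.inr rfl, hf, hg⟩]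

theorem finalState_pairRun (f g : (Fin n → Prop) → Prop) (acc : Set (Prop × Prop))
    (X : Fin n → M) :
    finalState (pairDFA f g acc) (fun a : Atom M => pairRun M f g X a) =
      (∃ b : Atom M, f (letter X b), ∃ b c : Atom M, b < c ∧ f (letter X b) ∧ g (letter X c)) := by
  cases isEmpty_or_nonempty (Atom M)
  · rw [finalState_of_isEmpty]
    simp [pairDFA]
  · obtain ⟨m, hm⟩ := Atom.exists_isMax (M := M)
    rw [finalState_of_isMax hm, pairRun_atom]
    have h : ∀ a, a ≤ m := fun a => hm.isTop a
    simp [h]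

end Runs

/-! ### Every formula is recognized by a finite automaton -/

/-- There is a finite automaton deciding `φ` in all models of `T_MSO(Fin)`. -/
def Recognizable {n : ℕ} (φ : BF n) : Prop :=
  ∃ (σ : Type) (_ : Finite σ) (D : DFA (Fin n → Prop) σ),
    ∀ (M : Type) [Lmso.Structure M] [M ⊨ TMSOFin], ∃ r : (Fin n → M) → M → σ,
      IsRunFamily D r ∧ ∀ X : Fin n → M,
        φ.Realize default X ↔ finalState D (fun a : Atom M => r X a) ∈ D.accept

section Recognizable

variable {n : ℕ}

theorem Recognizable.of_pair (φ : BF n) (f g : (Fin n → Prop) → Prop) (acc : Set (Prop × Prop))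
    (h : ∀ (M : Type) [Lmso.Structure M] [M ⊨ TMSOFin] (X : Fin n → M),
      φ.Realize default X ↔
        (∃ b : Atom M, f (letter X b),
          ∃ b c : Atom M, b < c ∧ f (letter X b) ∧ g (letter X c)) ∈ acc) :
    Recognizable φ :=
  ⟨Prop × Prop, inferInstance, pairDFA f g acc, fun M _ _ => ⟨pairRun M f g,
    isRunFamily_pairRun f g acc, fun X => by rw [finalState_pairRun]; exact h M X⟩⟩

/-- Membership of an atom in the value of a term depends on the letter only. -/
def termLetter (t : Lmso.Term (Empty ⊕ Fin n)) (l : Fin n → Prop) : Prop :=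
  match t with
  | Term.var (Sum.inr i) => l i
  | Term.var (Sum.inl e) => e.elim
  | Term.func _ _ => False

theorem termLetter_iff {M : Type*} [Lmso.Structure M] [M ⊨ TMSOFin] (X : Fin n → M)
    (t : Lmso.Term (Empty ⊕ Fin n)) (a : Atom M) :
    termLetter t (letter X a) ↔ subE (a : M) (t.realize (Sum.elim default X)) := by
  match t with
  | Term.var (Sum.inr i) => exact Iff.rfl
  | Term.var (Sum.inl e) => exact e.elim
  | Term.func (l := 0) f ts =>
    have : (Term.func f ts).realize (Sum.elim default X) = botE M :=
      congrArg (Structure.funMap botC) (Subsingleton.elim _ _)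
    rw [this]
    exact ⟨False.elim, not_subE_botE a.2⟩
  | Term.func (l := _ + 1) f ts => exact Empty.elim f

theorem Recognizable.falsum : Recognizable (BoundedFormula.falsum : BF n) :=
  .of_pair _ (fun _ => False) (fun _ => False) ∅ fun _ _ _ _ => by
    simp [BoundedFormula.Realize]

theorem Recognizable.equal (s t : Lmso.Term (Empty ⊕ Fin n)) :
    Recognizable (BoundedFormula.equal s t : BF n) :=
  .of_pair _ (fun l => ¬ (termLetter s l ↔ termLetter t l)) (fun _ => False) {q | ¬ q.1}
    fun M _ _ X => by
      simp only [termLetter_iff, Set.mem_ofPred_eq, not_exists, not_not]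
      exact Atom.eq_iff

theorem Recognizable.rel {k : ℕ} (R : Lmso.Relations k) (ts : Fin k → Lmso.Term (Empty ⊕ Fin n)) :
    Recognizable (BoundedFormula.rel R ts : BF n) := by
  match k, R with
  | 0, R => exact Empty.elim R
  | 1, R =>
    refine .of_pair _ (termLetter (ts 0)) (termLetter (ts 0)) {q | q.1 ∧ ¬ q.2} fun M _ _ X => ?_
    simp only [termLetter_iff, Set.mem_ofPred_eq]
    rw [← Atom.atE_iff]
    exact iff_of_eq (congrArg (Structure.RelMap atR) (funext fun i => by fin_cases i; rfl))
  | 2, true =>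
    refine .of_pair _ (fun l => ¬ (termLetter (ts 0) l → termLetter (ts 1) l)) (fun _ => False)
      {q | ¬ q.1} fun M _ _ X => ?_
    simp only [termLetter_iff, Set.mem_ofPred_eq, not_exists, not_not]
    rw [← Atom.subE_iff]
    exact iff_of_eq (congrArg (Structure.RelMap subR) (funext fun i => by fin_cases i <;> rfl))
  | 2, false =>
    refine .of_pair _ (termLetter (ts 0)) (termLetter (ts 1)) {q | q.2} fun M _ _ X => ?_
    simp only [termLetter_iff, Set.mem_ofPred_eq]
    rw [← Atom.exleE_iff]
    exact iff_of_eq (congrArg (Structure.RelMap exleR) (funext fun i => by fin_cases i <;> rfl))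
  | _ + 3, R => exact Empty.elim R

theorem Recognizable.imp {φ ψ : BF n} (hφ : Recognizable φ) (hψ : Recognizable ψ) :
    Recognizable (φ.imp ψ) := by
  obtain ⟨σ, _, D, h⟩ := hφ
  obtain ⟨τ, _, E, h'⟩ := hψ
  refine ⟨σ × τ, inferInstance, ⟨fun q l => (D.step q.1 l, E.step q.2 l), (D.start, E.start),
    {q | q.1 ∈ D.accept → q.2 ∈ E.accept}⟩, fun M _ _ => ?_⟩
  obtain ⟨r, hr, hD⟩ := h M
  obtain ⟨r', hr', hE⟩ := h' M
  refine ⟨fun X a => (r X a, r' X a), ⟨fun q => ?_, fun X => ⟨fun a ha => ?_, fun a b hab => ?_⟩⟩,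
    fun X => ?_⟩
  · exact ((hr.dfn q.1).and (hr'.dfn q.2)).congr fun w => by rw [Prod.ext_iff]
  · exact Prod.ext ((hr.isRun X).of_isMin a ha) ((hr'.isRun X).of_isMin a ha)
  · exact Prod.ext ((hr.isRun X).of_covBy a b hab) ((hr'.isRun X).of_covBy a b hab)
  · rw [BoundedFormula.realize_imp, hD, hE]
    cases isEmpty_or_nonempty (Atom M)
    · simp [finalState_of_isEmpty]
    · obtain ⟨m, hm⟩ := Atom.exists_isMax (M := M)
      simp [finalState_of_isMax hm]

theorem letter_snoc {M : Type*} [Lmso.Structure M] (X : Fin n → M) (y a : M) :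
    letter (Fin.snoc (α := fun _ => M) X y) a =
      Fin.snoc (α := fun _ => Prop) (letter X a) (subE a y) := by
  funext i
  refine Fin.lastCases ?_ (fun j => ?_) i <;> simp [letter]

/-- The subset automaton, guessing the last component of the letters. -/
def subsetDFA {σ : Type*} (D : DFA (Fin (n + 1) → Prop) σ) : DFA (Fin n → Prop) (Set σ) where
  step S l := {q | ∃ p ∈ S, ∃ b : Prop, q = D.step p (Fin.snoc (α := fun _ => Prop) l b)}
  start := {D.start}
  accept := {S | S ⊆ D.accept}

/-- The set of states reached at `a` when the last component of the word varies. -/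
def subsetRun {M σ : Type*} (r : (Fin (n + 1) → M) → M → σ) (X : Fin n → M) (a : M) : Set σ :=
  {q | ∃ y, r (Fin.snoc (α := fun _ => M) X y) a = q}

variable {M σ : Type*} [Lmso.Structure M] [M ⊨ TMSOFin]

theorem exists_atom_prefix (y : M) (a b : Atom M) (hab : a < b) (p : Prop) :
    ∃ z : M, (∀ c ≤ a, subE (c : M) z ↔ subE (c : M) y) ∧ (subE (b : M) z ↔ p) := by
  have hy : Internal {c : Atom M | subE (c : M) y} := ⟨y, fun _ => Iff.rfl⟩
  have hp : Internal {c : Atom M | c = b ∧ p} := by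
    by_cases hp : p
    · simpa [hp] using internal_singleton b
    · simpa [hp] using internal_empty (M := M)
  obtain ⟨z, hz⟩ := ((internal_Iic a).inter hy).union hp
  refine ⟨z, fun c hc => ?_, ?_⟩
  · rw [hz]
    have : c ≠ b := (hc.trans_lt hab).ne
    simp [hc, this]
  · rw [hz]
    simp [hab]

theorem exists_subE_iff (a : Atom M) (p : Prop) : ∃ z : M, subE (a : M) z ↔ p := by
  by_cases hp : p
  · exact ⟨a, by simp [hp, subE_refl]⟩
  · exact ⟨botE M, by simp [hp, not_subE_botE a.2]⟩

theorem isRunFamily_subsetRun [Finite σ] {D : DFA (Fin (n + 1) → Prop) σ}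
    {r : (Fin (n + 1) → M) → M → σ} (h : IsRunFamily D r) :
    IsRunFamily (subsetDFA D) (subsetRun r) where
  dfn S := by
    have key : ∀ q, Dfn (fun w : Fin n ⊕ Unit → M =>
        ∃ y, r (Fin.snoc (α := fun _ => M) (w ∘ Sum.inl) y) (w (Sum.inr ())) = q) := fun q => by
      refine Dfn.exists (((h.dfn q).comp (Sum.elim (Fin.snoc (α := fun _ => (Fin n ⊕ Unit) ⊕ Unit)
        (fun i => Sum.inl (Sum.inl i)) (Sum.inr ())) (fun _ => Sum.inl (Sum.inr ())))).congr
        fun w => ?_)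
      apply iff_of_eq
      congr 2
      funext i
      refine Fin.lastCases ?_ (fun j => ?_) i <;> simp
    refine (Dfn.finite_forall fun q => (key q).iff (Dfn.const (q ∈ S))).congr fun w => ?_
    exact Set.ext_iff.symm
  isRun X := by
    constructor
    · intro a ha
      ext q
      simp only [subsetRun, subsetDFA, Set.mem_ofPred_eq, Set.mem_singleton_iff,
        exists_eq_left]
      constructor
      · rintro ⟨y, rfl⟩
        exact ⟨subE (a : M) y, by rw [(h.isRun _).of_isMin a ha, letter_snoc]⟩
      · rintro ⟨p, rfl⟩
        obtain ⟨z, hz⟩ := exists_subE_iff a p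
        exact ⟨z, by rw [(h.isRun _).of_isMin a ha, letter_snoc, propext hz]⟩
    · intro a b hab
      ext q
      simp only [subsetRun, subsetDFA, Set.mem_ofPred_eq]
      constructor
      · rintro ⟨y, rfl⟩
        exact ⟨_, ⟨y, rfl⟩, subE (b : M) y, by rw [(h.isRun _).of_covBy a b hab, letter_snoc]⟩
      · rintro ⟨_, ⟨y, rfl⟩, p, rfl⟩
        obtain ⟨z, hz, hz'⟩ := exists_atom_prefix y a b hab.lt p
        refine ⟨z, ?_⟩
        have := (h.isRun (Fin.snoc X z)).eq_of_forall_le (h.isRun (Fin.snoc X y)) (h.internal _)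
          (h.internal _) a fun c hc => by rw [letter_snoc, letter_snoc, propext (hz c hc)]
        rw [(h.isRun _).of_covBy a b hab, letter_snoc, propext hz', this]

theorem finalState_subsetRun (D : DFA (Fin (n + 1) → Prop) σ)
    (r : (Fin (n + 1) → M) → M → σ) (X : Fin n → M) :
    finalState (subsetDFA D) (fun a : Atom M => subsetRun r X a) =
      {q | ∃ y, finalState D (fun a : Atom M => r (Fin.snoc (α := fun _ => M) X y) a) = q} := by
  cases isEmpty_or_nonempty (Atom M)
  · have : Nonempty M := ⟨botE M⟩
    ext q
    simp [finalState_of_isEmpty, subsetDFA, eq_comm]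
  · obtain ⟨m, hm⟩ := Atom.exists_isMax (M := M)
    simp only [finalState_of_isMax hm, subsetRun]

theorem Recognizable.all {φ : BF (n + 1)} (hφ : Recognizable φ) : Recognizable φ.all := by
  obtain ⟨σ, _, D, h⟩ := hφ
  refine ⟨Set σ, inferInstance, subsetDFA D, fun M _ _ => ?_⟩
  obtain ⟨r, hr, hD⟩ := h M
  refine ⟨subsetRun r, isRunFamily_subsetRun hr, fun X => ?_⟩
  rw [BoundedFormula.realize_all, finalState_subsetRun]
  simp only [hD, subsetDFA, Set.mem_ofPred_eq, Set.subset_def, forall_exists_index,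
    forall_apply_eq_imp_iff]

theorem recognizable (φ : BF n) : Recognizable φ := by
  induction φ with
  | falsum => exact .falsum
  | equal s t => exact .equal s t
  | rel R ts => exact .rel R ts
  | imp f g hf hg => exact hf.imp hg
  | all f hf => exact hf.all

end Recognizable

/-! ### Semantics of the sentences `ψ_{=n}`, `ψ_{>n}` and `ρ_{d,h}` -/

section Sentences

variable {M : Type*} [Lmso.Structure M]

theorem realize_distinctPairs {n : ℕ} (v : Empty → M) (xs : Fin n → M) :
    (∀ φ ∈ distinctPairs n, φ.Realize v xs) ↔ Function.Injective xs := by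
  have : (∀ φ ∈ distinctPairs n, φ.Realize v xs) ↔ ∀ i j : Fin n, i < j → xs i ≠ xs j := by
    simp only [distinctPairs, List.mem_flatMap, List.mem_filterMap, List.mem_finRange, true_and]
    constructor
    · intro h i j hij
      have := h (∼(eq' i j)) ⟨i, j, by simp [hij]⟩
      simpa using this
    · rintro h φ ⟨i, j, hφ⟩
      split_ifs at hφ with hij
      obtain rfl := Option.some.inj hφ
      simpa using h i j hij
  rw [this]
  refine ⟨fun h i j hij => ?_, fun h i j hij => h.ne hij.ne⟩
  rcases lt_trichotomy i j with h' | h' | h'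
  exacts [absurd hij (h i j h'), h', absurd hij.symm (h j i h')]

theorem realize_psiGt {n : ℕ} (v : Empty → M) (xs : Fin 0 → M) :
    BoundedFormula.Realize (psiGt n) v xs ↔
      ∃ g : Fin (n + 1) → Atom M, Function.Injective g := by
  obtain rfl : xs = default := Subsingleton.elim _ _
  rw [psiGt]
  refine (BoundedFormula.realize_exs).trans ?_
  simp only [BoundedFormula.realize_inf, realize_bigAnd, realize_distinctPairs, List.mem_map,
    List.mem_finRange, true_and, forall_exists_index, forall_apply_eq_imp_iff, realize_at']
  constructor
  · rintro ⟨x, hx, hinj⟩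
    exact ⟨fun i => ⟨x i, hx i⟩, fun i j hij => hinj (Subtype.ext_iff.1 hij)⟩
  · rintro ⟨g, hg⟩
    exact ⟨fun i => g i, fun i => (g i).2, Subtype.val_injective.comp hg⟩

theorem realize_psiEq {n : ℕ} (v : Empty → M) (xs : Fin 0 → M) :
    BoundedFormula.Realize (psiEq n) v xs ↔ ∃ g : Fin n → Atom M, Function.Bijective g := by
  obtain rfl : xs = default := Subsingleton.elim _ _
  rw [psiEq]
  refine (BoundedFormula.realize_exs).trans ?_
  simp only [BoundedFormula.realize_inf, realize_bigAnd, realize_distinctPairs, List.mem_map,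
    List.mem_finRange, true_and, forall_exists_index, forall_apply_eq_imp_iff, realize_at',
    BoundedFormula.realize_all, BoundedFormula.realize_imp, realize_bigOr,
    exists_exists_eq_and, realize_eq', Fin.snoc_last, Fin.snoc_castSucc]
  constructor
  · rintro ⟨x, ⟨hx, hinj⟩, hsurj⟩
    refine ⟨fun i => ⟨x i, hx i⟩, fun i j hij => hinj (Subtype.ext_iff.1 hij), fun a => ?_⟩
    obtain ⟨i, hi⟩ := hsurj a a.2
    exact ⟨i, Subtype.ext hi.symm⟩
  · rintro ⟨g, hg⟩
    refine ⟨fun i => g i, ⟨fun i => (g i).2, Subtype.val_injective.comp hg.1⟩, fun a ha => ?_⟩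
    obtain ⟨i, hi⟩ := hg.2 ⟨a, ha⟩
    exact ⟨i, (congrArg Subtype.val hi).symm⟩

variable [M ⊨ TMSOFin]

theorem realize_isLeastAtom {n : ℕ} (i : Fin n) (v : Empty → M) (xs : Fin n → M) :
    (isLeastAtom i).Realize v xs ↔ ∃ a : Atom M, IsMin a ∧ (a : M) = xs i := by
  simp only [isLeastAtom, BoundedFormula.realize_inf, realize_at', BoundedFormula.realize_all,
    BoundedFormula.realize_imp, BoundedFormula.realize_not, realize_exle', Fin.snoc_last,
    Fin.snoc_castSucc]
  constructor
  · rintro ⟨h, hmin⟩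
    exact ⟨⟨_, h⟩, fun b _ => hmin b b.2, rfl⟩
  · rintro ⟨a, ha, hai⟩
    rw [← hai]
    exact ⟨a.2, fun b hb => ha.isBot ⟨b, hb⟩⟩

theorem realize_isGreatestAtom {n : ℕ} (i : Fin n) (v : Empty → M) (xs : Fin n → M) :
    (isGreatestAtom i).Realize v xs ↔ ∃ a : Atom M, IsMax a ∧ (a : M) = xs i := by
  simp only [isGreatestAtom, BoundedFormula.realize_inf, realize_at', BoundedFormula.realize_all,
    BoundedFormula.realize_imp, BoundedFormula.realize_not, realize_exle', Fin.snoc_last,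
    Fin.snoc_castSucc]
  constructor
  · rintro ⟨h, hmax⟩
    exact ⟨⟨_, h⟩, fun b _ => hmax b b.2, rfl⟩
  · rintro ⟨a, ha, hai⟩
    rw [← hai]
    exact ⟨a.2, fun b hb => ha.isTop ⟨b, hb⟩⟩

theorem realize_isSuccOf {n : ℕ} (j i : Fin n) (v : Empty → M) (xs : Fin n → M) :
    (isSuccOf j i).Realize v xs ↔
      ∃ a b : Atom M, a ⋖ b ∧ (a : M) = xs i ∧ (b : M) = xs j := by
  simp only [isSuccOf, BoundedFormula.realize_inf, realize_at', BoundedFormula.realize_all,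
    BoundedFormula.realize_imp, BoundedFormula.realize_sup, realize_exle', realize_eq',
    Fin.snoc_last, Fin.snoc_castSucc]
  constructor
  · rintro ⟨⟨⟨hi, hj⟩, hij⟩, h⟩
    refine ⟨⟨_, hi⟩, ⟨_, hj⟩, ⟨hij, fun c hac hcb => ?_⟩, rfl, rfl⟩
    rcases h c ⟨c.2, hac⟩ with h | h
    · exact hcb.ne (Subtype.ext h)
    · exact lt_asymm hcb h
  · rintro ⟨a, b, hab, hai, hbj⟩
    rw [← hai, ← hbj]
    refine ⟨⟨⟨a.2, b.2⟩, hab.lt⟩, fun c hc => ?_⟩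
    obtain ⟨c, rfl⟩ : ∃ c' : Atom M, (c' : M) = c := ⟨⟨c, hc.1⟩, rfl⟩
    rcases lt_trichotomy c b with h | h | h
    · exact absurd h (hab.2 hc.2)
    · exact Or.inl (congrArg Subtype.val h)
    · exact Or.inr h

theorem realize_rho {d h : ℕ} (hd : 0 < d) (v : Empty → M) (xs : Fin 0 → M) :
    BoundedFormula.Realize (rho d h) v xs ↔ ∃ A : Fin d → M,
      (∀ i, ∃ a : Atom M, subE (a : M) (A i)) ∧
      (∀ a : Atom M, ∃ i, subE (a : M) (A i)) ∧
      (∀ i j, i < j → ∀ a : Atom M, ¬ (subE (a : M) (A i) ∧ subE (a : M) (A j))) ∧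
      (∀ a : Atom M, IsMin a → subE (a : M) (A (aIdx d 1 hd))) ∧
      (∀ j, ∀ a b : Atom M, subE (a : M) (A j) → a ⋖ b → subE (b : M) (A (cyc j))) ∧
      (∀ a : Atom M, IsMax a → subE (a : M) (A (aIdx d h hd))) := by
  obtain rfl : xs = default := Subsingleton.elim _ _
  rw [rho, dif_pos hd]
  refine (BoundedFormula.realize_exs).trans (exists_congr fun A => ?_)
  simp only [BoundedFormula.realize_inf, realize_bigAnd, and_assoc]
  refine and_congr ?_ (and_congr ?_ (and_congr ?_ (and_congr ?_ (and_congr ?_ ?_))))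
  · simp [← ne_eq, Atom.ne_botE_iff]
  · simp only [BoundedFormula.realize_all, BoundedFormula.realize_imp, realize_at', realize_bigOr,
      Fin.snoc_last, List.mem_map, List.mem_finRange, true_and, exists_exists_eq_and,
      realize_sub', Fin.snoc_castSucc]
    exact ⟨fun h a => h a a.2, fun h a ha => h ⟨a, ha⟩⟩
  · simp only [List.mem_flatMap, List.mem_filterMap, List.mem_finRange, true_and]
    constructor
    · intro h i j hij a
      have := h _ ⟨i, j, if_pos hij⟩
      simp only [BoundedFormula.realize_all, BoundedFormula.realize_imp, realize_at',
        BoundedFormula.realize_not, BoundedFormula.realize_inf, realize_sub', Fin.snoc_last,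
        Fin.snoc_castSucc] at this
      exact this a a.2
    · rintro h φ ⟨i, j, hφ⟩
      split_ifs at hφ with hij
      obtain rfl := Option.some.inj hφ
      simp only [BoundedFormula.realize_all, BoundedFormula.realize_imp, realize_at',
        BoundedFormula.realize_not, BoundedFormula.realize_inf, realize_sub', Fin.snoc_last,
        Fin.snoc_castSucc]
      exact fun a ha => h i j hij ⟨a, ha⟩
  · simp only [BoundedFormula.realize_all, BoundedFormula.realize_imp, realize_isLeastAtom,
      realize_sub', Fin.snoc_last, Fin.snoc_castSucc]
    exact ⟨fun h a ha => h a ⟨a, ha, rfl⟩, fun h x ⟨a, ha, hax⟩ => hax ▸ h a ha⟩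
  · simp only [List.mem_map, List.mem_finRange, true_and, forall_exists_index,
      forall_apply_eq_imp_iff, BoundedFormula.realize_all, BoundedFormula.realize_imp,
      BoundedFormula.realize_inf, realize_isSuccOf, realize_sub', Fin.snoc_last,
      Fin.snoc_castSucc]
    refine forall_congr' fun j => ⟨fun h a b ha hab => h a b ⟨ha, a, b, hab, rfl, rfl⟩, ?_⟩
    rintro h x y ⟨hx, a, b, hab, rfl, rfl⟩
    exact h a b hx hab
  · simp only [BoundedFormula.realize_all, BoundedFormula.realize_imp, realize_isGreatestAtom,
      realize_sub', Fin.snoc_last, Fin.snoc_castSucc]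
    exact ⟨fun h a ha => h a ⟨a, ha, rfl⟩, fun h x ⟨a, ha, hax⟩ => hax ▸ h a ha⟩

end Sentences

/-! ### Iterating a map along the atoms -/

section Orbits

variable {M : Type*} [Lmso.Structure M] [M ⊨ TMSOFin] {σ : Type*}

/-- `r` assigns the iterates `f s, f (f s), …` to the atoms of `M`, in order, with internal
fibers. -/
structure IsOrbit (f : σ → σ) (s : σ) (r : Atom M → σ) : Prop where
  of_isMin : ∀ a, IsMin a → r a = f s
  of_covBy : ∀ a b, a ⋖ b → r b = f (r a)
  internal : ∀ q, Internal (r ⁻¹' {q})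

variable {f : σ → σ} {s : σ} {r : Atom M → σ}

theorem IsOrbit.iterate [Finite σ] (hr : IsOrbit f s r) (e : ℕ) :
    IsOrbit f (f^[e] s) (fun a => f^[e] (r a)) where
  of_isMin a ha := by
    rw [hr.of_isMin a ha, ← Function.iterate_succ_apply, Function.iterate_succ_apply']
  of_covBy a b hab := by
    rw [hr.of_covBy a b hab, ← Function.iterate_succ_apply, Function.iterate_succ_apply']
  internal q := Internal.preimage hr.internal (f^[e] ⁻¹' {q})

/-- Either there are at most `n` atoms, or the first `n + 1` atoms can be enumerated. -/
theorem IsOrbit.le_or_gt (hr : IsOrbit f s r) (n : ℕ) :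
    (∃ m ≤ n, (∃ g : Fin m → Atom M, Function.Bijective g) ∧
      ((m = 0 ∧ IsEmpty (Atom M)) ∨ ∃ a, IsMax a ∧ r a = f^[m] s)) ∨
    ∃ g : Fin (n + 1) → Atom M, Function.Injective g ∧
      ∃ b, Set.range g = Set.Iic b ∧ r b = f^[n + 1] s := by
  induction n with
  | zero =>
    rcases isEmpty_or_nonempty (Atom M) with h | h
    · exact Or.inl ⟨0, le_rfl, ⟨Fin.elim0, fun i => i.elim0, fun a => h.elim a⟩, Or.inl ⟨rfl, h⟩⟩
    · obtain ⟨a, ha⟩ := Atom.exists_isMin (M := M)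
      refine Or.inr ⟨fun _ => a, fun i j _ => Subsingleton.elim (α := Fin 1) i j, a, ?_,
        hr.of_isMin a ha⟩
      ext x
      simp only [Set.mem_range, exists_const, Set.mem_Iic]
      exact ⟨fun h => h.ge, fun h => (ha.isBot x).antisymm h⟩
  | succ n ih =>
    rcases ih with ⟨m, hm, h⟩ | ⟨g, hg, b, hgb, hb⟩
    · exact Or.inl ⟨m, hm.trans n.le_succ, h⟩
    by_cases hmax : IsMax b
    · refine Or.inl ⟨n + 1, le_rfl, ⟨g, hg, fun a => ?_⟩, Or.inr ⟨b, hmax, hb⟩⟩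
      exact hgb.ge (hmax.isTop a)
    · obtain ⟨c, hbc⟩ := Atom.exists_covBy_right hmax
      refine Or.inr ⟨Fin.cons c g, Fin.cons_injective_iff.2 ⟨?_, hg⟩, c, ?_, ?_⟩
      · rw [hgb]
        exact not_le_of_gt hbc.lt
      · rw [Fin.range_cons, hgb]
        ext x
        simp only [Set.mem_insert_iff, Set.mem_Iic]
        constructor
        · rintro (rfl | h)
          exacts [le_rfl, h.trans hbc.le]
        · intro h
          rcases h.eq_or_lt with h | h
          exacts [Or.inl h, Or.inr (le_of_not_gt fun h' => hbc.2 h' h)]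
      · rw [hr.of_covBy b c hbc, hb, ← Function.iterate_succ_apply' f]

theorem IsOrbit.exists_eq_iterate (hr : IsOrbit f s r) {n : ℕ}
    {g : Fin (n + 1) → Atom M} (hg : Function.Injective g) : ∃ a, r a = f^[n + 1] s := by
  rcases hr.le_or_gt n with ⟨m, hm, ⟨g', hg'⟩, -⟩ | ⟨-, -, b, -, hb⟩
  · obtain ⟨k, hk⟩ := hg'.2.hasRightInverse
    have := Fintype.card_le_of_injective _ (hk.injective.comp hg)
    simp only [Fintype.card_fin] at this
    omega
  · exact ⟨b, hb⟩

/-- Being fixed by `f^[e]` propagates along an orbit. -/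
theorem IsOrbit.iterate_eq_of_le [Finite σ] (hr : IsOrbit f s r) {e : ℕ} {b : Atom M}
    (hb : f^[e] (r b) = r b) {a : Atom M} (ha : b ≤ a) : f^[e] (r a) = r a := by
  refine (Internal.preimage hr.internal {q | f^[e] q = q}).induction_Ici b hb
    (fun x y _ hxy hx => ?_) ha
  change f^[e] (r y) = r y
  rw [hr.of_covBy x y hxy, ← Function.iterate_succ_apply, Function.iterate_succ_apply',
    show f^[e] (r x) = r x from hx]

theorem val_aIdx {d h : ℕ} (hd : 0 < d) (h1 : 1 ≤ h) (h2 : h ≤ d) :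
    (aIdx d h hd : ℕ) = h - 1 := by
  simp only [aIdx]
  rw [show h + d - 1 = h - 1 + d by omega, Nat.add_mod_right, Nat.mod_eq_of_lt (by omega)]

theorem iterate_cyc {d : ℕ} (hd : Function.minimalPeriod f s = d) (j : Fin d) :
    f^[(cyc j : ℕ) + 1] s = f (f^[(j : ℕ) + 1] s) := by
  subst hd
  rw [Function.iterate_succ_apply', cyc, Function.iterate_mod_minimalPeriod_eq]

theorem iterate_succ_injective {d : ℕ} (hd : Function.minimalPeriod f s = d) :
    Function.Injective (fun j : Fin d => f^[(j : ℕ) + 1] s) := by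
  subst hd
  intro i j hij
  have hpos : 0 < Function.minimalPeriod f s := i.pos
  have hs := Function.minimalPeriod_pos_iff_mem_periodicPts.1 hpos
  have hfs : Function.minimalPeriod f (f s) = Function.minimalPeriod f s :=
    Function.minimalPeriod_apply hs
  exact Fin.ext ((Function.iterate_eq_iterate_iff_of_lt_minimalPeriod
    (by rw [hfs]; exact i.2) (by rw [hfs]; exact j.2)).1 hij)

theorem IsOrbit.exists_fin [Finite σ] (hr : IsOrbit f s r) {d : ℕ} (hpos : 0 < d)
    (hd : Function.minimalPeriod f s = d) (a : Atom M) :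
    ∃ j : Fin d, r a = f^[(j : ℕ) + 1] s := by
  refine (Internal.preimage hr.internal {q | ∃ j : Fin d, q = f^[(j : ℕ) + 1] s}).induction
    (fun a ha => ⟨⟨0, hpos⟩, hr.of_isMin a ha⟩) ?_ a
  rintro a b hab ⟨j, hj⟩
  exact ⟨cyc j, by rw [iterate_cyc hd, ← hj, hr.of_covBy a b hab]⟩

/-- The sentence `ρ_{d,h}` computes the last element of an orbit that is a cycle of length `d`. -/
theorem IsOrbit.realize_rho_iff [Finite σ] (hr : IsOrbit f s r) {d h : ℕ} (h1 : 1 ≤ h) (h2 : h ≤ d)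
    (hd : Function.minimalPeriod f s = d) {g : Fin d → Atom M} (hg : Function.Injective g)
    {a : Atom M} (ha : IsMax a) (v : Empty → M) (xs : Fin 0 → M) :
    BoundedFormula.Realize (rho d h) v xs ↔ r a = f^[h] s := by
  have hpos : 0 < d := by omega
  have hidx : (aIdx d h hpos : ℕ) + 1 = h := by rw [val_aIdx hpos h1 h2]; omega
  have hidx1 : (aIdx d 1 hpos : ℕ) + 1 = 1 := by rw [val_aIdx hpos le_rfl hpos]
  rw [realize_rho hpos]
  constructor
  · rintro ⟨A, -, -, hdisj, hmin, hsucc, hmax⟩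
    have hI : Internal
        {b : Atom M | ∃ j : Fin d, subE (b : M) (A j) ∧ r b = f^[(j : ℕ) + 1] s} := by
      have := Internal.iUnion (ι := Fin d) fun j =>
        Internal.inter (U := {b | subE (b : M) (A j)}) ⟨A j, fun _ => Iff.rfl⟩
          (hr.internal (f^[(j : ℕ) + 1] s))
      convert this using 1
      ext b
      simp
    obtain ⟨j, hj, hja⟩ := hI.induction
      (fun b hb => ⟨_, hmin b hb, by rw [hidx1, hr.of_isMin b hb, Function.iterate_one]⟩)
      (fun b c hbc ⟨j, hj, hjb⟩ => ⟨_, hsucc j b c hj hbc, by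
        rw [iterate_cyc hd, ← hjb, hr.of_covBy b c hbc]⟩) a
    have hja' : j = aIdx d h hpos := by
      by_contra hne
      rcases lt_or_gt_of_ne hne with hlt | hlt
      exacts [hdisj _ _ hlt a ⟨hj, hmax a ha⟩, hdisj _ _ hlt a ⟨hmax a ha, hj⟩]
    rw [hja, hja', hidx]
  · intro hra
    choose A hA using fun j : Fin d => hr.internal (f^[(j : ℕ) + 1] s)
    simp only [Set.mem_preimage, Set.mem_singleton_iff] at hA
    refine ⟨A, fun j => ?_, fun b => ?_, fun i j hij b => ?_, fun b hb => ?_, fun j b c => ?_,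
      fun b hb => ?_⟩
    · obtain ⟨b, hb⟩ := hr.exists_eq_iterate (n := j)
        (hg.comp (Fin.castLE_injective (Nat.succ_le_of_lt j.2)))
      exact ⟨b, (hA j b).2 hb⟩
    · obtain ⟨j, hj⟩ := hr.exists_fin hpos hd b
      exact ⟨j, (hA j b).2 hj⟩
    · rw [hA, hA]
      rintro ⟨hi, hj⟩
      exact hij.ne (iterate_succ_injective hd (hi.symm.trans hj))
    · rw [hA, hidx1, hr.of_isMin b hb, Function.iterate_one]
    · rw [hA, hA]
      intro hb hbc
      rw [iterate_cyc hd, ← hb, hr.of_covBy b c hbc]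
    · rw [hA, hidx, ← hra, (hb.isTop a).antisymm (ha.isTop b)]

/-- A self-map of a finite type reaches a cycle, after a number of steps divisible by the length
of the cycle. -/
theorem exists_dvd_minimalPeriod_iterate [Finite σ] (f : σ → σ) (s : σ) :
    ∃ e, 0 < Function.minimalPeriod f (f^[e] s) ∧ Function.minimalPeriod f (f^[e] s) ∣ e := by
  obtain ⟨i, j, hij, h⟩ := Finite.exists_ne_map_eq_of_infinite fun k : ℕ => f^[k] s
  wlog hlt : i < j generalizing i j
  · exact this j i hij.symm h.symm (by omega)
  have hp : f^[i] s ∈ Function.periodicPts f := by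
    refine ⟨j - i, by omega, ?_⟩
    rw [Function.IsPeriodicPt, Function.IsFixedPt, ← Function.iterate_add_apply,
      Nat.sub_add_cancel hlt.le]
    exact h.symm
  have hpos := Function.minimalPeriod_pos_of_mem_periodicPts hp
  have hle : i ≤ Function.minimalPeriod f (f^[i] s) * i := Nat.le_mul_of_pos_left i hpos
  have key : Function.minimalPeriod f (f^[Function.minimalPeriod f (f^[i] s) * i] s) =
      Function.minimalPeriod f (f^[i] s) := by
    conv_lhs => rw [← Nat.sub_add_cancel hle, Function.iterate_add_apply]
    exact Function.minimalPeriod_apply_iterate hp _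
  exact ⟨_, by rwa [key], by rw [key]; exact dvd_mul_right _ _⟩

end Orbits

theorem statement15 (φ : Lmso.Sentence) :
    ∃ (N d : ℕ), 0 < d ∧ ∃ (I R : Finset ℕ),
      (∀ i ∈ I, i ≤ N) ∧ (∀ h ∈ R, 1 ≤ h ∧ h ≤ d) ∧
      TMSOFin ⊨ᵇ (φ ⇔ (bigOr (I.toList.map psiEq) ⊔ (psiGt N ⊓ bigOr (R.toList.map (rho d))))) := by
  classical
  obtain ⟨σ, _, D, hD⟩ := recognizable φ
  obtain ⟨e, hpos, hdvd⟩ := exists_dvd_minimalPeriod_iterate (fun q => D.step q default) D.start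
  set f : σ → σ := fun q => D.step q default with hf
  set c := f^[e] D.start with hc
  obtain ⟨d, hd⟩ : ∃ d, Function.minimalPeriod f c = d := ⟨_, rfl⟩
  rw [hd] at hpos hdvd
  have hper : f^[e] c = c := (Function.isPeriodicPt_iff_minimalPeriod_dvd (f := f)).2 (hd ▸ hdvd)
  refine ⟨max e d, d, hpos, {i ∈ Finset.range (max e d + 1) | f^[i] D.start ∈ D.accept},
    {h ∈ Finset.Icc 1 d | f^[h] c ∈ D.accept},
    fun i hi => Nat.lt_succ_iff.1 (Finset.mem_range.1 (Finset.mem_filter.1 hi).1),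
    fun h hh => Finset.mem_Icc.1 (Finset.mem_filter.1 hh).1, ?_⟩
  intro M v xs
  obtain ⟨r', hr', hφ⟩ := hD M
  have hφ' := hφ xs
  obtain rfl : v = default := Subsingleton.elim _ _
  rw [BoundedFormula.realize_iff, hφ']
  set r : Atom M → σ := fun a => r' xs a with hrdef
  have hr : IsOrbit f D.start r :=
    ⟨fun a ha => ((hr'.isRun xs).of_isMin a ha).trans (congrArg _ (Subsingleton.elim _ _)),
      fun a b hab => ((hr'.isRun xs).of_covBy a b hab).trans (congrArg _ (Subsingleton.elim _ _)),
      hr'.internal xs⟩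
  simp only [BoundedFormula.realize_sup, BoundedFormula.realize_inf, realize_bigOr, List.mem_map,
    Finset.mem_toList, exists_exists_and_eq_and, Finset.mem_filter, Finset.mem_range,
    Finset.mem_Icc, realize_psiEq, realize_psiGt, Nat.lt_succ_iff]
  rcases hr.le_or_gt (max e d) with ⟨m, hm, ⟨g, hg⟩, hlast⟩ | ⟨g, hg, b, hgb, hb⟩
  · have hfin : finalState D r = f^[m] D.start := by
      rcases hlast with ⟨rfl, h⟩ | ⟨a, ha, hra⟩
      · exact finalState_of_isEmpty D r
      · rw [finalState_of_isMax ha, hra]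
    rw [hfin]
    constructor
    · exact fun h => Or.inl ⟨m, ⟨hm, h⟩, g, hg⟩
    · rintro (⟨i, ⟨hi, h⟩, g', hg'⟩ | ⟨⟨g', hg'⟩, -⟩)
      · have := Fintype.card_congr ((Equiv.ofBijective g hg).trans (Equiv.ofBijective g' hg').symm)
        simp only [Fintype.card_fin] at this
        rwa [this]
      · have := Fintype.card_le_of_injective _
          ((Equiv.ofBijective g hg).symm.injective.comp hg')
        simp only [Fintype.card_fin] at this
        omega
  · have : Nonempty (Atom M) := ⟨b⟩
    obtain ⟨a, ha⟩ := Atom.exists_isMax (M := M)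
    have hra : f^[e] (r a) = r a := by
      refine hr.iterate_eq_of_le ?_ (ha.isTop b)
      rw [hb, show max e d + 1 = (max e d + 1 - e) + e by omega, Function.iterate_add_apply,
        ← hc, ← Function.iterate_add_apply, Nat.add_comm e, Function.iterate_add_apply, hper]
    have hrho : ∀ h, 1 ≤ h ∧ h ≤ d →
        (BoundedFormula.Realize (rho d h) default xs ↔ r a = f^[h] c) := fun h hh => by
      rw [(hr.iterate e).realize_rho_iff hh.1 hh.2 hd
        (hg.comp (Fin.castLE_injective (by omega : d ≤ max e d + 1))) ha, hra]
    rw [finalState_of_isMax ha]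
    constructor
    · intro h
      obtain ⟨j, hj⟩ := (hr.iterate e).exists_fin hpos hd a
      rw [hra] at hj
      have hj' : 1 ≤ (j : ℕ) + 1 ∧ (j : ℕ) + 1 ≤ d := by omega
      exact Or.inr ⟨⟨g, hg⟩, _, ⟨hj', hj ▸ h⟩, (hrho _ hj').2 hj⟩
    · rintro (⟨i, ⟨hi, -⟩, g', hg'⟩ | ⟨-, h, ⟨hh, h'⟩, hrh⟩)
      · have := Fintype.card_le_of_injective _
          ((Equiv.ofBijective g' hg').symm.injective.comp hg)
        simp only [Fintype.card_fin] at this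
        omega
      · rwa [(hrho h hh).1 hrh]
end MSO
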